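/- arXiv:1009.5302 — 3 statements merged into one kernel-verified Lean document; each statement's English description precedes it below -/
import Mathlib

section
/- Let A ⊂ ℝ² be an open set containing (0,0), let h: A → ℝ be continuous, and let F: A → ℝ be continuous with F(0,0) = 0. Assume that every solution τ: I → ℝ of the ODE τ̇(η) = h(η,τ(η)) on a compact interval I, whose graph is contained in A, has the property that η ↦ F(η,τ(η)) is strictly increasing on I. Then there exist a compact neighbourhood U ⊂ A of the origin and an injective continuous curve ζ: [0,1] → U such that ζ([0,1]) = U ∩ F⁻¹(0). -/
noncomputable section

open Set

/-- `τ` is a (C¹) solution of the ODE `τ̇ η = h (η, τ η)` on the set `S ⊆ ℝ`, with graph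
contained in the open set `A`. -/
def IsODESolOn (A : Set (ℝ × ℝ)) (h : ℝ × ℝ → ℝ) (S : Set ℝ) (τ : ℝ → ℝ) : Prop :=
  (∀ η ∈ S, (η, τ η) ∈ A) ∧ ∀ η ∈ S, HasDerivWithinAt τ (h (η, τ η)) S η

/-- `d` is a modulus for `H` at accuracy `ε` along `M`-Lipschitz displacements. -/
def LSModulus (H : ℝ × ℝ → ℝ) (M ε d : ℝ) : Prop :=
  0 < d ∧ ∀ a b y z : ℝ, |a - b| < d → |y - z| ≤ M * |a - b| → |H (a, y) - H (b, z)| ≤ ε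

/-- Quantitative, pointwise closed, form of being a solution on `S`. -/
def LSEst (H : ℝ × ℝ → ℝ) (M : ℝ) (S : Set ℝ) (τ : ℝ → ℝ) : Prop :=
  (∀ a ∈ S, ∀ b ∈ S, a ≤ b → |τ b - τ a| ≤ M * (b - a)) ∧
  ∀ ε > 0, ∀ d, LSModulus H M ε d → ∀ a ∈ S, ∀ b ∈ S, a ≤ b → b - a < d →
    |τ b - τ a - (b - a) * H (a, τ a)| ≤ ε * (b - a)

/-- Global solutions. -/
def LSSol (H : ℝ × ℝ → ℝ) (τ : ℝ → ℝ) : Prop :=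
  ∀ η, HasDerivAt τ (H (η, τ η)) η

/-- Assumptions on the bounded, uniformly continuous right-hand side. -/
def LSNice (H : ℝ × ℝ → ℝ) (M : ℝ) : Prop :=
  0 ≤ M ∧ (∀ p, |H p| ≤ M) ∧ Continuous H ∧ ∀ ε > 0, ∃ d, LSModulus H M ε d

lemma LSEst.hasDeriv {H : ℝ × ℝ → ℝ} {M : ℝ} (hH : LSNice H M) {S : Set ℝ} {τ : ℝ → ℝ}
    (hτ : LSEst H M S τ) (η : ℝ) (hη : η ∈ S) : HasDerivWithinAt τ (H (η, τ η)) S η := by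
  obtain ⟨hM0, hM, hc, hU⟩ := hH
  rw [hasDerivWithinAt_iff_isLittleO, Asymptotics.isLittleO_iff]
  intro c hc0
  obtain ⟨d, hd⟩ := hU (c / 2) (by positivity)
  have hd0 := hd.1
  have hev : ∀ᶠ x in nhdsWithin η S, |x - η| < d := by
    apply nhdsWithin_le_nhds
    have := Metric.ball_mem_nhds η hd0
    filter_upwards [this] with x hx
    simpa [Real.dist_eq] using hx
  filter_upwards [hev, self_mem_nhdsWithin] with x hx hxS
  simp only [Real.norm_eq_abs, smul_eq_mul]
  rcases le_total η x with hle | hle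
  · rw [abs_of_nonneg (sub_nonneg.2 hle)] at hx ⊢
    have := hτ.2 (c / 2) (by positivity) d hd η hη x hxS hle hx
    nlinarith [sub_nonneg.2 hle]
  · have hx' : η - x < d := by rw [abs_sub_comm] at hx; exact (le_abs_self _).trans_lt hx
    have h1 := hτ.2 (c / 2) (by positivity) d hd x hxS η hη hle hx'
    have h2 := hd.2 η x (τ η) (τ x) (by rw [abs_sub_comm]; exact hx)
      (by rw [abs_of_nonneg (sub_nonneg.2 hle)]; exact hτ.1 x hxS η hη hle)
    have e : τ x - τ η - (x - η) * H (η, τ η) =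
        -(τ η - τ x - (η - x) * H (x, τ x)) + (η - x) * (H (η, τ η) - H (x, τ x)) := by ring
    rw [e, abs_sub_comm x η, abs_of_nonneg (sub_nonneg.2 hle)]
    refine (abs_add_le _ _).trans ?_
    rw [abs_neg, abs_mul, abs_of_nonneg (sub_nonneg.2 hle)]
    nlinarith [sub_nonneg.2 hle]

lemma LSSol.lip {H : ℝ × ℝ → ℝ} {M : ℝ} (hH : LSNice H M) {τ : ℝ → ℝ}
    (hτ : LSSol H τ) (a b : ℝ) : |τ b - τ a| ≤ M * |b - a| := by
  have := convex_univ.norm_image_sub_le_of_norm_hasDerivWithin_le (f := τ)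
    (f' := fun η => H (η, τ η)) (C := M) (fun x _ => (hτ x).hasDerivWithinAt)
    (fun x _ => hH.2.1 _) (mem_univ a) (mem_univ b)
  simpa using this

lemma LSSol.est {H : ℝ × ℝ → ℝ} {M : ℝ} (hH : LSNice H M) {τ : ℝ → ℝ}
    (hτ : LSSol H τ) : LSEst H M univ τ := by
  refine ⟨fun a _ b _ hab => ?_, fun ε hε d hd a _ b _ hab hbd => ?_⟩
  · have := hτ.lip hH a b
    rwa [abs_of_nonneg (sub_nonneg.2 hab)] at this
  · have := (convex_Icc a b).norm_image_sub_le_of_norm_hasDerivWithin_le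
      (f := fun t => τ t - t * H (a, τ a))
      (f' := fun η => H (η, τ η) - 1 * H (a, τ a)) (C := ε)
      (fun x _ => ((hτ x).sub ((hasDerivAt_id x).mul_const _)).hasDerivWithinAt)
      (fun x hx => by
        rw [one_mul]
        apply hd.2
        · rw [abs_of_nonneg (sub_nonneg.2 hx.1)]; linarith [hx.2]
        · exact hτ.lip hH a x) (left_mem_Icc.2 hab) (right_mem_Icc.2 hab)
    rw [Real.norm_eq_abs, Real.norm_eq_abs, abs_of_nonneg (sub_nonneg.2 hab)] at this
    refine le_of_eq_of_le ?_ this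
    congr 1; ring

lemma LSSol_iff {H : ℝ × ℝ → ℝ} {M : ℝ} (hH : LSNice H M) {τ : ℝ → ℝ} :
    LSSol H τ ↔ LSEst H M univ τ :=
  ⟨fun h => h.est hH, fun h η => by
    simpa using (h.hasDeriv hH η (mem_univ _))⟩

lemma LSSol.continuous {H : ℝ × ℝ → ℝ} {τ : ℝ → ℝ} (hτ : LSSol H τ) : Continuous τ :=
  continuous_iff_continuousAt.2 fun x => (hτ x).continuousAt

lemma LSSol_isClosed {H : ℝ × ℝ → ℝ} {M : ℝ} (hH : LSNice H M) :
    IsClosed {τ : ℝ → ℝ | LSSol H τ} := by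
  simp only [LSSol_iff hH, LSEst, ofPred_and, ofPred_forall]
  have hc := hH.2.2.1
  refine IsClosed.inter ?_ ?_
  · refine isClosed_iInter fun a => isClosed_iInter fun _ => isClosed_iInter fun b =>
      isClosed_iInter fun _ => isClosed_iInter fun _ => isClosed_le (by fun_prop) (by fun_prop)
  · refine isClosed_iInter fun ε => isClosed_iInter fun _ => isClosed_iInter fun d =>
      isClosed_iInter fun _ => isClosed_iInter fun a => isClosed_iInter fun _ =>
      isClosed_iInter fun b => isClosed_iInter fun _ => isClosed_iInter fun _ =>
      isClosed_iInter fun _ => isClosed_le (by fun_prop) (by fun_prop)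

/-- Euler iterates. -/
def LSEuler (H : ℝ × ℝ → ℝ) (x0 y0 e : ℝ) : ℕ → ℝ
  | 0 => y0
  | k + 1 => LSEuler H x0 y0 e k + e * H (x0 + k * e, LSEuler H x0 y0 e k)

lemma LSEuler_lip {H : ℝ × ℝ → ℝ} {M : ℝ} (hH : LSNice H M) (x0 y0 e : ℝ) (he : 0 < e)
    (i n : ℕ) : |LSEuler H x0 y0 e (i + n) - LSEuler H x0 y0 e i| ≤ M * (n * e) := by
  induction n with
  | zero => simp
  | succ n ih =>
    have h1 := hH.2.1 (x0 + (i + n : ℕ) * e, LSEuler H x0 y0 e (i + n))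
    rw [← add_assoc, LSEuler]
    rw [abs_le] at *
    push_cast at *
    constructor <;> nlinarith

lemma LSEuler_est {H : ℝ × ℝ → ℝ} {M : ℝ} (hH : LSNice H M) (x0 y0 e : ℝ) (he : 0 < e)
    {ε d : ℝ} (hd : LSModulus H M ε d) (i n : ℕ) (hn : n * e < d) :
    |LSEuler H x0 y0 e (i + n) - LSEuler H x0 y0 e i
      - n * e * H (x0 + i * e, LSEuler H x0 y0 e i)| ≤ ε * (n * e) := by
  induction n with
  | zero => simp
  | succ n ih =>
    push_cast at hn
    have hn' : n * e < d := by nlinarith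
    have ih := ih hn'
    have hpos : 0 ≤ (n : ℝ) * e := by positivity
    have h1 := hd.2 (x0 + (i + n : ℕ) * e) (x0 + i * e) (LSEuler H x0 y0 e (i + n))
      (LSEuler H x0 y0 e i)
      (by push_cast; rw [show x0 + (i + n) * e - (x0 + i * e) = n * e by ring, abs_of_nonneg hpos]
          exact hn')
      (by push_cast; rw [show x0 + (i + n) * e - (x0 + i * e) = n * e by ring, abs_of_nonneg hpos]
          exact LSEuler_lip hH x0 y0 e he i n)
    rw [← add_assoc, LSEuler]
    rw [abs_le] at *
    push_cast at *
    constructor <;> nlinarith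

open Filter Topology in
lemma LS_forward {H : ℝ × ℝ → ℝ} {M : ℝ} (hH : LSNice H M) (x0 y0 : ℝ) :
    ∃ τ : ℝ → ℝ, τ x0 = y0 ∧ ∀ η ∈ Ici x0, HasDerivWithinAt τ (H (η, τ η)) (Ici x0) η := by
  set e : ℕ → ℝ := fun N => 1 / ((N : ℝ) + 1) with he
  have he0 : ∀ N, 0 < e N := fun N => by simp only [he]; positivity
  set k : ℕ → ℝ → ℕ := fun N η => ⌊(η - x0) / e N⌋₊ with hk
  set f : ℕ → ℝ → ℝ := fun N η => LSEuler H x0 y0 (e N) (k N η) with hf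
  let u : Ultrafilter ℕ := hyperfilter ℕ
  have hu : (u : Filter ℕ) ≤ atTop := Nat.hyperfilter_le_atTop
  have hetend : Tendsto e u (𝓝 0) := tendsto_one_div_add_atTop_nhds_zero_nat.mono_left hu
  have hkle : ∀ N, ∀ η, x0 ≤ η → k N η * e N ≤ η - x0 := fun N η hη => by
    have := Nat.floor_le (div_nonneg (sub_nonneg.2 hη) (he0 N).le)
    rwa [le_div_iff₀ (he0 N)] at this
  have hklt : ∀ N, ∀ η, η - x0 < k N η * e N + e N := fun N η => by
    have := Nat.lt_floor_add_one ((η - x0) / e N)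
    rw [div_lt_iff₀ (he0 N)] at this
    linarith
  have hktend : ∀ η, x0 ≤ η → Tendsto (fun N => (k N η : ℝ) * e N) u (𝓝 (η - x0)) := by
    intro η hη
    have h1 : Tendsto (fun N => η - x0 - e N) u (𝓝 (η - x0)) := by
      simpa using hetend.const_sub (η - x0)
    exact tendsto_of_tendsto_of_tendsto_of_le_of_le h1 tendsto_const_nhds
      (fun N => by have := hklt N η; simp only; linarith) (fun N => hkle N η hη)
  have hlim : ∀ η, ∃ y, x0 ≤ η → Tendsto (fun N => f N η) u (𝓝 y) := by
    intro η
    by_cases hη : x0 ≤ η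
    · have hcpt : IsCompact (Icc (y0 - M * (η - x0)) (y0 + M * (η - x0))) := isCompact_Icc
      obtain ⟨y, -, hy⟩ := hcpt.ultrafilter_le_nhds (u.map fun N => f N η) (by
        rw [le_principal_iff]
        refine Eventually.of_forall (f := (u : Filter ℕ)) fun N => ?_
        have h1 := LSEuler_lip hH x0 y0 (e N) (he0 N) 0 (k N η)
        have h2 := hkle N η hη
        have h3 := mul_le_mul_of_nonneg_left h2 hH.1
        rw [zero_add, abs_le] at h1
        simp only [LSEuler] at h1
        constructor <;> simp only [hf] <;> linarith [h1.1, h1.2])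
      exact ⟨y, fun _ => hy⟩
    · exact ⟨0, fun h => absurd h hη⟩
  choose τ hτ using hlim
  refine ⟨τ, ?_, ?_⟩
  · have h1 := hτ x0 le_rfl
    have h2 : (fun N => f N x0) = fun _ => y0 := by
      funext N; simp [hf, hk, LSEuler]
    rw [h2] at h1
    exact tendsto_nhds_unique h1 tendsto_const_nhds
  · apply LSEst.hasDeriv hH
    have hkmono : ∀ N a b, a ≤ b → k N a ≤ k N b := fun N a b hab => by
      apply Nat.floor_mono
      have := he0 N
      gcongr
    have hdiff : ∀ a b, x0 ≤ a → a ≤ b →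
        Tendsto (fun N => ((k N b - k N a : ℕ) : ℝ) * e N) u (𝓝 (b - a)) := by
      intro a b ha hab
      have := (hktend b (ha.trans hab)).sub (hktend a ha)
      rw [show b - x0 - (a - x0) = b - a by ring] at this
      refine this.congr fun N => ?_
      rw [Nat.cast_sub (hkmono N a b hab)]; ring
    refine ⟨fun a ha b hb hab => ?_, fun ε hε d hd a ha b hb hab hbd => ?_⟩
    · refine le_of_tendsto_of_tendsto ((hτ b hb).sub (hτ a ha)).abs
        ((hdiff a b ha hab).const_mul M) (Eventually.of_forall fun N => ?_)
      have := LSEuler_lip hH x0 y0 (e N) (he0 N) (k N a) (k N b - k N a)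
      rwa [Nat.add_sub_cancel' (hkmono N a b hab)] at this
    · have hx : Tendsto (fun N => x0 + k N a * e N) u (𝓝 a) := by
        simpa using (hktend a ha).const_add x0
      have hHt : Tendsto (fun N => H (x0 + k N a * e N, f N a)) u (𝓝 (H (a, τ a))) :=
        (hH.2.2.1.tendsto (a, τ a)).comp (hx.prodMk_nhds (hτ a ha))
      refine le_of_tendsto_of_tendsto
        (((hτ b hb).sub (hτ a ha)).sub ((hdiff a b ha hab).mul hHt)).abs
        ((hdiff a b ha hab).const_mul ε) ?_
      filter_upwards [(hdiff a b ha hab).eventually (gt_mem_nhds hbd)] with N hN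
      have := LSEuler_est hH x0 y0 (e N) (he0 N) hd (k N a) (k N b - k N a) hN
      rwa [Nat.add_sub_cancel' (hkmono N a b hab)] at this

lemma LSNice.reflect {H : ℝ × ℝ → ℝ} {M : ℝ} (hH : LSNice H M) :
    LSNice (fun p => - H (-p.1, p.2)) M := by
  obtain ⟨hM0, hM, hc, hU⟩ := hH
  refine ⟨hM0, fun p => by rw [abs_neg]; exact hM _, by fun_prop, fun ε hε => ?_⟩
  obtain ⟨d, hd0, hd⟩ := hU ε hε
  refine ⟨d, hd0, fun a b y z h1 h2 => ?_⟩
  have e : |-a - -b| = |a - b| := by rw [← abs_neg]; congr 1; ring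
  have := hd (-a) (-b) y z (by rwa [e]) (by rwa [e])
  simp only
  rw [← abs_neg]
  convert this using 2
  ring

/-- Peano existence. -/
lemma LS_peano {H : ℝ × ℝ → ℝ} {M : ℝ} (hH : LSNice H M) (x0 y0 : ℝ) :
    ∃ τ : ℝ → ℝ, τ x0 = y0 ∧ LSSol H τ := by
  obtain ⟨f, hf0, hf⟩ := LS_forward hH x0 y0
  obtain ⟨g, hg0, hg⟩ := LS_forward hH.reflect (-x0) y0
  classical
  have hg' : ∀ η ∈ Iic x0, HasDerivWithinAt (fun t => g (-t)) (H (η, g (-η))) (Iic x0) η := by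
    intro η hη
    have h1 := hg (-η) (by simpa using hη)
    have h2 := HasDerivWithinAt.comp η (s' := Ici (-x0)) (s := Iic x0) (h := fun t => -t) h1
      (hasDerivAt_neg η).hasDerivWithinAt (fun t ht => by simpa using ht)
    simpa [Function.comp_def] using h2
  let τ : ℝ → ℝ := fun t => if t < x0 then g (-t) else f t
  have hτ1 : EqOn τ f (Ici x0) := fun t ht => by
    simp only [τ]; rw [if_neg (not_lt.2 ht)]
  have hτ2 : EqOn τ (fun t => g (-t)) (Iic x0) := fun t ht => by
    simp only [τ]
    rcases (mem_Iic.1 ht).lt_or_eq with h | h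
    · rw [if_pos h]
    · subst h; simp [hf0, hg0]
  have k1 : ∀ η ∈ Ici x0, HasDerivWithinAt τ (H (η, τ η)) (Ici x0) η := fun η hη => by
    rw [hτ1 hη]; exact (hf η hη).congr hτ1 (hτ1 hη)
  have k2 : ∀ η ∈ Iic x0, HasDerivWithinAt τ (H (η, τ η)) (Iic x0) η := fun η hη => by
    rw [hτ2 hη]; exact (hg' η hη).congr hτ2 (hτ2 hη)
  refine ⟨τ, by rw [hτ1 self_mem_Ici, hf0], fun η => ?_⟩
  rcases lt_trichotomy η x0 with h | h | h
  · exact (k2 η h.le).hasDerivAt (Iic_mem_nhds h)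
  · subst h
    have := (k2 η self_mem_Iic).union (k1 η self_mem_Ici)
    rwa [Iic_union_Ici, hasDerivWithinAt_univ] at this
  · exact (k1 η h.le).hasDerivAt (Ici_mem_nhds h)

lemma LS_hasDerivAt_select {f g m : ℝ → ℝ} {d x : ℝ} (hf : HasDerivAt f d x)
    (hg : HasDerivAt g d x) (hfg : f x = g x) (hm : ∀ y, m y = f y ∨ m y = g y) :
    HasDerivAt m d x := by
  have hmx : m x = f x := by rcases hm x with h | h <;> simp [h, hfg]
  rw [hasDerivAt_iff_isLittleO, Asymptotics.isLittleO_iff] at *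
  intro c hc
  filter_upwards [hf hc, hg hc] with y h1 h2
  rcases hm y with h | h
  · rw [h, hmx]; exact h1
  · rw [h, hmx, hfg]; exact h2

lemma LSSol.max {H : ℝ × ℝ → ℝ} {f g : ℝ → ℝ} (hf : LSSol H f) (hg : LSSol H g) :
    LSSol H (fun t => max (f t) (g t)) := by
  intro η
  rcases lt_trichotomy (f η) (g η) with h | h | h
  · simp only [max_eq_right h.le]
    refine (hg η).congr_of_eventuallyEq ?_
    filter_upwards [hf.continuous.continuousAt.eventually_lt hg.continuous.continuousAt h] with t ht
    exact max_eq_right ht.le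
  · have e : Max.max (f η) (g η) = f η := by simp [h]
    simp only [e]
    refine LS_hasDerivAt_select (hf η) (by rw [h]; exact hg η) h fun y => max_choice _ _
  · simp only [max_eq_left h.le]
    refine (hf η).congr_of_eventuallyEq ?_
    filter_upwards [hg.continuous.continuousAt.eventually_lt hf.continuous.continuousAt h] with t ht
    exact max_eq_left ht.le

lemma LSSol.min {H : ℝ × ℝ → ℝ} {f g : ℝ → ℝ} (hf : LSSol H f) (hg : LSSol H g) :
    LSSol H (fun t => min (f t) (g t)) := by
  intro η
  rcases lt_trichotomy (f η) (g η) with h | h | h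
  · simp only [min_eq_left h.le]
    refine (hf η).congr_of_eventuallyEq ?_
    filter_upwards [hf.continuous.continuousAt.eventually_lt hg.continuous.continuousAt h] with t ht
    exact min_eq_left ht.le
  · have e : Min.min (f η) (g η) = f η := by simp [h]
    simp only [e]
    refine LS_hasDerivAt_select (hf η) (by rw [h]; exact hg η) h fun y => min_choice _ _
  · simp only [min_eq_right h.le]
    refine (hg η).congr_of_eventuallyEq ?_
    filter_upwards [hg.continuous.continuousAt.eventually_lt hf.continuous.continuousAt h] with t ht
    exact min_eq_right ht.le

/-- A strictly monotone continuous functional on continuous functions. -/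
def LSFun (τ : ℝ → ℝ) : ℝ :=
  ∑' n : ℕ, (1 / 2 : ℝ) ^ n * Real.arctan (τ (TopologicalSpace.denseSeq ℝ n))

lemma LSFun_bound (n : ℕ) (x : ℝ) : ‖(1 / 2 : ℝ) ^ n * Real.arctan x‖ ≤ (1 / 2 : ℝ) ^ n * 2 := by
  rw [norm_mul, Real.norm_eq_abs, Real.norm_eq_abs, abs_of_nonneg (by positivity : (0:ℝ) ≤ (1/2)^n)]
  gcongr
  rw [abs_le]
  constructor <;> linarith [Real.neg_pi_div_two_lt_arctan x, Real.arctan_lt_pi_div_two x,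
    Real.pi_lt_four]

lemma LSFun_summable : Summable fun n : ℕ => (1 / 2 : ℝ) ^ n * 2 :=
  summable_geometric_two.mul_right 2

lemma LSFun_continuous : Continuous LSFun := by
  refine continuous_tsum (fun n => ?_) LSFun_summable (fun n τ => LSFun_bound n _)
  exact continuous_const.mul (Real.continuous_arctan.comp (continuous_apply _))

lemma LSFun_mono {f g : ℝ → ℝ} (h : f ≤ g) : LSFun f ≤ LSFun g := by
  refine Summable.tsum_le_tsum (fun n => ?_)
    (Summable.of_norm_bounded LSFun_summable fun n => LSFun_bound n _)
    (Summable.of_norm_bounded LSFun_summable fun n => LSFun_bound n _)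
  exact mul_le_mul_of_nonneg_left (Real.arctan_strictMono.monotone (h _)) (by positivity)

lemma LSFun_strict {f g : ℝ → ℝ} (hf : Continuous f) (hg : Continuous g) (h : f ≤ g)
    (hne : f ≠ g) : LSFun f < LSFun g := by
  have : ∃ n, f (TopologicalSpace.denseSeq ℝ n) ≠ g (TopologicalSpace.denseSeq ℝ n) := by
    by_contra! hcon
    exact hne ((TopologicalSpace.denseRange_denseSeq ℝ).equalizer hf hg (funext hcon))
  obtain ⟨n, hn⟩ := this
  refine Summable.tsum_lt_tsum (i := n) (fun n => ?_) ?_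
    (Summable.of_norm_bounded LSFun_summable fun n => LSFun_bound n _)
    (Summable.of_norm_bounded LSFun_summable fun n => LSFun_bound n _)
  · exact mul_le_mul_of_nonneg_left (Real.arctan_strictMono.monotone (h _)) (by positivity)
  · exact mul_lt_mul_of_pos_left (Real.arctan_strictMono (lt_of_le_of_ne (h _) hn)) (by positivity)

/-- Monotone continuous family of solutions joining two ordered solutions. -/
lemma LS_family {H : ℝ × ℝ → ℝ} {M : ℝ} (hH : LSNice H M) {f g : ℝ → ℝ}
    (hf : LSSol H f) (hg : LSSol H g) (hfg : f ≤ g) :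
    ∃ (T : ℝ → ℝ → ℝ) (a b : ℝ), a ≤ b ∧ (∀ s, LSSol H (T s)) ∧ Monotone T ∧
      (∀ η, Continuous fun s => T s η) ∧ T a = f ∧ T b = g ∧ ∀ s, f ≤ T s ∧ T s ≤ g := by
  let X : Set (ℝ → ℝ) := {τ | LSSol H τ} ∩ Icc f g
  have hXc : IsCompact X := by
    have h1 : IsCompact (Icc f g) := isCompact_Icc
    exact h1.inter_left (LSSol_isClosed hH)
  have : CompactSpace X := isCompact_iff_compactSpace.1 hXc
  let C : Set X := maxChain (· ≤ ·)
  have hC : IsMaxChain (· ≤ ·) C := maxChain_spec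
  have hCtot : ∀ x ∈ C, ∀ y ∈ C, x ≤ y ∨ y ≤ x := fun x hx y hy => hC.1.total hx hy
  have hCmem : ∀ x : X, (∀ y ∈ C, x ≤ y ∨ y ≤ x) → x ∈ C := by
    intro x hx
    have h1 : IsChain (· ≤ ·) (insert x C) := hC.1.insert fun y hy _ => hx y hy
    rw [hC.2 h1 (subset_insert _ _)]
    exact mem_insert _ _
  have hCcl : IsClosed C := by
    have hset : C = ⋂ y ∈ C, {x : X | x ≤ y ∨ y ≤ x} := by
      ext x
      simp only [mem_iInter, mem_ofPred_eq]
      exact ⟨fun hx y hy => hCtot x hx y hy, hCmem x⟩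
    rw [hset]
    refine isClosed_biInter fun y _ => ?_
    have l1 : IsClosed {x : X | x ≤ y} :=
      isClosed_le (f := fun x : X => (x : ℝ → ℝ)) continuous_subtype_val continuous_const
    have l2 : IsClosed {x : X | y ≤ x} :=
      isClosed_le (g := fun x : X => (x : ℝ → ℝ)) continuous_const continuous_subtype_val
    exact l1.union l2
  let S : X → ℝ := fun x => LSFun x
  have hSc : Continuous S := LSFun_continuous.comp continuous_subtype_val
  have hSm : ∀ x y : X, x ≤ y → S x ≤ S y := fun x y h => LSFun_mono h
  have hSs : ∀ x ∈ C, ∀ y ∈ C, S x ≤ S y → x ≤ y := by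
    intro x hx y hy h
    rcases hCtot x hx y hy with h' | h'
    · exact h'
    · by_contra hcon
      have hne : (y : ℝ → ℝ) ≠ x := fun e => hcon (le_of_eq (Subtype.ext e.symm))
      exact absurd (LSFun_strict y.2.1.continuous x.2.1.continuous h' hne) (not_lt.2 h)
  have hSinj : ∀ x ∈ C, ∀ y ∈ C, S x = S y → x = y := fun x hx y hy h =>
    le_antisymm (hSs x hx y hy h.le) (hSs y hy x hx h.ge)
  let bot : X := ⟨f, hf, le_rfl, hfg⟩
  let top : X := ⟨g, hg, hfg, le_rfl⟩
  have hbot : bot ∈ C := hCmem _ fun y _ => Or.inl y.2.2.1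
  have htop : top ∈ C := hCmem _ fun y _ => Or.inr y.2.2.2
  have hCk : IsCompact C := hCcl.isCompact
  have himg : ∀ c ∈ Icc (S bot) (S top), ∃ x ∈ C, S x = c := by
    intro c hc
    by_contra! hcon
    have kL : IsCompact (C ∩ {x | S x ≤ c}) := hCk.inter_right (isClosed_le hSc continuous_const)
    have kR : IsCompact (C ∩ {x | c ≤ S x}) := hCk.inter_right (isClosed_le continuous_const hSc)
    obtain ⟨x, ⟨hx, hxc⟩, hxm⟩ := kL.exists_isMaxOn ⟨bot, hbot, hc.1⟩ hSc.continuousOn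
    obtain ⟨y, ⟨hy, hyc⟩, hym⟩ := kR.exists_isMinOn ⟨top, htop, hc.2⟩ hSc.continuousOn
    have hxc' : S x < c := lt_of_le_of_ne hxc (hcon x hx)
    have hyc' : c < S y := lt_of_le_of_ne hyc (hcon y hy).symm
    have hxy : x ≤ y := hSs x hx y hy (hxc'.trans hyc').le
    have hne : ∃ η, (x : ℝ → ℝ) η < (y : ℝ → ℝ) η := by
      by_contra! h
      have : y ≤ x := h
      exact absurd (hSm _ _ this) (not_le.2 (hxc'.trans hyc'))
    obtain ⟨η, hη⟩ := hne
    obtain ⟨σ, hσ0, hσ⟩ := LS_peano hH η (((x : ℝ → ℝ) η + (y : ℝ → ℝ) η) / 2)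
    have hz : LSSol H (fun t => max ((x : ℝ → ℝ) t) (min ((y : ℝ → ℝ) t) (σ t))) :=
      LSSol.max x.2.1 (LSSol.min y.2.1 hσ)
    have hxz : (x : ℝ → ℝ) ≤ (fun t => max ((x : ℝ → ℝ) t) (min ((y : ℝ → ℝ) t) (σ t))) :=
      fun t => le_max_left _ _
    have hzy : (fun t => max ((x : ℝ → ℝ) t) (min ((y : ℝ → ℝ) t) (σ t))) ≤ (y : ℝ → ℝ) :=
      fun t => max_le (hxy t) (min_le_left _ _)
    let z : X := ⟨_, hz, x.2.2.1.trans hxz, hzy.trans y.2.2.2⟩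
    have hzη : (z : ℝ → ℝ) η = ((x : ℝ → ℝ) η + (y : ℝ → ℝ) η) / 2 := by
      simp only [z, hσ0]
      rw [min_eq_right (by linarith), max_eq_right (by linarith)]
    have hzC : z ∈ C := by
      refine hCmem z fun w hw => ?_
      rcases le_total (S w) c with h | h
      · have h1 : w ≤ x := hSs w hw x hx (hxm ⟨hw, h⟩)
        exact Or.inr (h1.trans hxz)
      · have h1 : y ≤ w := hSs y hy w hw (hym ⟨hw, h⟩)
        exact Or.inl (le_trans (show z ≤ y from hzy) h1)
    rcases le_total (S z) c with h | h
    · have h1 : z ≤ x := hSs z hzC x hx (hxm ⟨hzC, h⟩)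
      have := h1 η
      linarith
    · have h1 : y ≤ z := hSs y hy z hzC (hym ⟨hzC, h⟩)
      have := h1 η
      linarith
  have hab : S bot ≤ S top := hSm _ _ (show bot ≤ top from hfg)
  have hrange : ∀ x ∈ C, S x ∈ Icc (S bot) (S top) := fun x _ => ⟨hSm _ _ x.2.2.1, hSm _ _ x.2.2.2⟩
  let Φ : C → Icc (S bot) (S top) := fun x => ⟨S x, hrange x x.2⟩
  have hΦc : Continuous Φ := (hSc.comp continuous_subtype_val).subtype_mk _
  have hΦb : Function.Bijective Φ := by
    constructor
    · intro x y h
      exact Subtype.ext (hSinj x x.2 y y.2 (congrArg Subtype.val h))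
    · rintro ⟨c, hc⟩
      obtain ⟨x, hx, rfl⟩ := himg c hc
      exact ⟨⟨x, hx⟩, rfl⟩
  have : CompactSpace C := isCompact_iff_compactSpace.1 hCk
  let E : C ≃ Icc (S bot) (S top) := Equiv.ofBijective Φ hΦb
  let Eh : C ≃ₜ Icc (S bot) (S top) := Continuous.homeoOfEquivCompactToT2 (f := E) hΦc
  have hE : ∀ c, S (Eh.symm c) = c := fun c => congrArg Subtype.val (Eh.apply_symm_apply c)
  let T : ℝ → ℝ → ℝ := fun s => ((Eh.symm (projIcc _ _ hab s) : X) : ℝ → ℝ)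
  have hTval : ∀ x : X, x ∈ C → T (S x) = x := by
    intro x hx
    have h1 : Eh.symm (projIcc _ _ hab (S x)) = ⟨x, hx⟩ := by
      rw [projIcc_of_mem hab (hrange x hx)]
      exact Eh.symm_apply_apply ⟨x, hx⟩
    simp only [T, h1]
  refine ⟨T, S bot, S top, hab, fun s => (Eh.symm _ : X).2.1, ?_, ?_, hTval bot hbot,
    hTval top htop, fun s => (Eh.symm _ : X).2.2⟩
  · intro s t hst
    refine hSs _ (Subtype.mem _) _ (Subtype.mem _) ?_
    rw [hE, hE]
    exact monotone_projIcc hab hst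
  · intro η
    exact (continuous_apply η).comp (continuous_subtype_val.comp (continuous_subtype_val.comp
      (Eh.symm.continuous.comp continuous_projIcc)))

/-- Running oscillation of `P` from `q`. -/
def LSOsc (P : ℝ → ℝ × ℝ) (q s : ℝ) : ℝ :=
  sSup ((fun t => dist (P (q + t * max (s - q) 0)) (P q)) '' Icc (0 : ℝ) 1)

lemma LSOsc_bdd {P : ℝ → ℝ × ℝ} (hP : Continuous P) (q s : ℝ) :
    BddAbove ((fun t => dist (P (q + t * max (s - q) 0)) (P q)) '' Icc (0 : ℝ) 1) :=
  (isCompact_Icc.image (by fun_prop)).bddAbove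

lemma LSOsc_continuous {P : ℝ → ℝ × ℝ} (hP : Continuous P) (q : ℝ) :
    Continuous (LSOsc P q) := by
  refine IsCompact.continuous_sSup (f := fun s t => dist (P (q + t * max (s - q) 0)) (P q))
    isCompact_Icc ?_
  simp only [Function.HasUncurry.uncurry, id]
  fun_prop

lemma LSOsc_nonneg {P : ℝ → ℝ × ℝ} (q s : ℝ) : 0 ≤ LSOsc P q s := by
  apply Real.sSup_nonneg
  rintro _ ⟨t, _, rfl⟩
  exact dist_nonneg

lemma LSOsc_le {P : ℝ → ℝ × ℝ} (hP : Continuous P) {q r s : ℝ} (h1 : q ≤ r) (h2 : r ≤ s) :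
    dist (P r) (P q) ≤ LSOsc P q s := by
  apply le_csSup (LSOsc_bdd hP q s)
  rcases h1.eq_or_lt with h | h
  · subst h
    exact ⟨0, by simp, by simp⟩
  · have hs : 0 < s - q := by linarith
    refine ⟨(r - q) / (s - q), ⟨by apply div_nonneg <;> linarith, ?_⟩, ?_⟩
    · rw [div_le_one hs]; linarith
    · simp only
      rw [max_eq_left hs.le, div_mul_cancel₀ _ hs.ne']
      congr 2; ring

lemma LSOsc_le_of {P : ℝ → ℝ × ℝ} {q s c : ℝ} (hc : 0 ≤ c)
    (h : ∀ r, q ≤ r → r ≤ s → dist (P r) (P q) ≤ c) : LSOsc P q s ≤ c := by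
  apply Real.sSup_le _ hc
  rintro _ ⟨t, ht, rfl⟩
  rcases le_total s q with hs | hs
  · simp only [max_eq_right (sub_nonpos.2 hs), mul_zero, add_zero, dist_self]; exact hc
  · simp only [max_eq_left (sub_nonneg.2 hs)]
    apply h
    · nlinarith [ht.1]
    · nlinarith [ht.2]

lemma LSOsc_mono {P : ℝ → ℝ × ℝ} (hP : Continuous P) {q s t : ℝ} (h : s ≤ t) :
    LSOsc P q s ≤ LSOsc P q t :=
  LSOsc_le_of (LSOsc_nonneg q t) fun _ h1 h2 => LSOsc_le hP h1 (h2.trans h)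

/-- Monotone function constant exactly on the fibres. -/
def LSPar (P : ℝ → ℝ × ℝ) (s : ℝ) : ℝ :=
  ∑' n : ℕ, (1 / 2 : ℝ) ^ n * Real.arctan (LSOsc P (TopologicalSpace.denseSeq ℝ n) s)

lemma LSPar_continuous {P : ℝ → ℝ × ℝ} (hP : Continuous P) : Continuous (LSPar P) := by
  refine continuous_tsum (fun n => ?_) LSFun_summable (fun n τ => LSFun_bound n _)
  exact continuous_const.mul (Real.continuous_arctan.comp (LSOsc_continuous hP _))

lemma LSPar_strict {P : ℝ → ℝ × ℝ} (hP : Continuous P) {s t : ℝ} (h : s ≤ t)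
    (hne : P s ≠ P t) : LSPar P s < LSPar P t := by
  have hst : s < t := lt_of_le_of_ne h fun e => hne (by rw [e])
  have hopen : IsOpen (Ioo s t ∩ {x | P x ≠ P t}) :=
    isOpen_Ioo.inter (isOpen_ne_fun hP continuous_const)
  have hnon : (Ioo s t ∩ {x | P x ≠ P t}).Nonempty := by
    have h1 : ∀ᶠ x in nhdsWithin s (Ioi s), P x ≠ P t :=
      nhdsWithin_le_nhds ((isOpen_ne_fun hP continuous_const).mem_nhds hne)
    have h2 : ∀ᶠ x in nhdsWithin s (Ioi s), x ∈ Ioo s t := Ioo_mem_nhdsGT hst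
    obtain ⟨x, hx⟩ := (h2.and h1).exists
    exact ⟨x, hx⟩
  obtain ⟨_, ⟨hq, hqt⟩, ⟨n, rfl⟩⟩ :=
    (TopologicalSpace.denseRange_denseSeq ℝ).inter_open_nonempty _ hopen hnon
  refine Summable.tsum_lt_tsum (i := n) (fun n => ?_) ?_
    (Summable.of_norm_bounded LSFun_summable fun n => LSFun_bound n _)
    (Summable.of_norm_bounded LSFun_summable fun n => LSFun_bound n _)
  · exact mul_le_mul_of_nonneg_left (Real.arctan_strictMono.monotone (LSOsc_mono hP h))
      (by positivity)
  · refine mul_lt_mul_of_pos_left (Real.arctan_strictMono ?_) (by positivity)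
    have h1 : LSOsc P (TopologicalSpace.denseSeq ℝ n) s ≤ 0 :=
      LSOsc_le_of le_rfl fun r h1 h2 => absurd (h1.trans h2) (not_le.2 hq.1)
    have h2 := LSOsc_le hP hq.2.le le_rfl
    have h3 : 0 < dist (P t) (P (TopologicalSpace.denseSeq ℝ n)) := dist_pos.2 (Ne.symm hqt)
    linarith

lemma LSPar_const {P : ℝ → ℝ × ℝ} (hP : Continuous P) {s t : ℝ} (h : s ≤ t)
    (hc : ∀ r, s ≤ r → r ≤ t → P r = P s) : LSPar P s = LSPar P t := by
  unfold LSPar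
  congr 1
  funext n
  congr 2
  refine le_antisymm (LSOsc_mono hP h) (LSOsc_le_of (LSOsc_nonneg _ _) fun r h1 h2 => ?_)
  rcases le_total r s with h' | h'
  · exact LSOsc_le hP h1 h'
  · rw [hc r h' h2]
    rcases le_total (TopologicalSpace.denseSeq ℝ n) s with h'' | h''
    · exact LSOsc_le hP h'' le_rfl
    · rw [hc _ h'' (h1.trans h2), dist_self]; exact LSOsc_nonneg _ _

lemma LS_arc {P : ℝ → ℝ × ℝ} (hP : Continuous P) {a b : ℝ} (hab : a ≤ b)
    (hfib : ∀ s t, P s = P t → ∀ r, s ≤ r → r ≤ t → P r = P s) (hne : P a ≠ P b) :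
    ∃ ζ : ℝ → ℝ × ℝ, ContinuousOn ζ (Icc 0 1) ∧ InjOn ζ (Icc 0 1) ∧
      ζ '' Icc 0 1 = P '' Icc a b := by
  set g := LSPar P with hg
  have hgc : Continuous g := LSPar_continuous hP
  have hlt : g a < g b := LSPar_strict hP hab hne
  have hiff : ∀ s t, g s = g t ↔ P s = P t := by
    have key : ∀ s t, s ≤ t → (g s = g t ↔ P s = P t) := fun s t h =>
      ⟨fun e => by
        by_contra hcon
        exact absurd e (LSPar_strict hP h hcon).ne,
       fun e => LSPar_const hP h (hfib s t e)⟩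
    intro s t
    rcases le_total s t with h | h
    · exact key s t h
    · rw [eq_comm, key t s h, eq_comm]
  have hmono : ∀ s t, s ≤ t → g s ≤ g t := fun s t h => by
    by_cases e : P s = P t
    · exact ((hiff s t).2 e).le
    · exact (LSPar_strict hP h e).le
  have hsurj : ∀ c : Icc (g a) (g b), ∃ s ∈ Icc a b, g s = c := fun c =>
    intermediate_value_Icc hab hgc.continuousOn c.2
  choose σ hσ1 hσ2 using hsurj
  let Φ : Icc a b → Icc (g a) (g b) := fun s => ⟨g s, hmono _ _ s.2.1, hmono _ _ s.2.2⟩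
  have hΦ : Continuous Φ := (hgc.comp continuous_subtype_val).subtype_mk _
  have hΦs : Function.Surjective Φ := fun c => ⟨⟨σ c, hσ1 c⟩, Subtype.ext (hσ2 c)⟩
  have hΦq : Topology.IsQuotientMap Φ := hΦ.isClosedMap.isQuotientMap hΦ hΦs
  have hψ : Continuous fun c : Icc (g a) (g b) => P (σ c) := by
    rw [hΦq.continuous_iff]
    have : (fun c : Icc (g a) (g b) => P (σ c)) ∘ Φ = fun s : Icc a b => P s := by
      funext s
      exact (hiff _ _).1 (hσ2 (Φ s))
    rw [this]
    exact hP.comp continuous_subtype_val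
  have hL : ∀ x ∈ Icc (0 : ℝ) 1, g a + x * (g b - g a) ∈ Icc (g a) (g b) := fun x hx =>
    ⟨by nlinarith [hx.1], by nlinarith [hx.2]⟩
  let ζ : ℝ → ℝ × ℝ := fun x => P (σ (projIcc _ _ hlt.le (g a + x * (g b - g a))))
  have hζ : ∀ x (hx : x ∈ Icc (0 : ℝ) 1), ζ x = P (σ ⟨_, hL x hx⟩) := fun x hx => by
    simp only [ζ, projIcc_of_mem hlt.le (hL x hx)]
  refine ⟨ζ, ?_, ?_, ?_⟩
  · apply Continuous.continuousOn
    exact hψ.comp (continuous_projIcc.comp (by fun_prop))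
  · intro x hx y hy hxy
    rw [hζ x hx, hζ y hy, ← hiff, hσ2, hσ2] at hxy
    have h0 : g b - g a ≠ 0 := by linarith
    have : x * (g b - g a) = y * (g b - g a) := by linarith
    exact mul_right_cancel₀ h0 this
  · ext p
    constructor
    · rintro ⟨x, hx, rfl⟩
      rw [hζ x hx]
      exact ⟨_, hσ1 _, rfl⟩
    · rintro ⟨s, hs, rfl⟩
      have h0 : 0 < g b - g a := by linarith
      have h1 := hmono _ _ hs.1
      have h2 := hmono _ _ hs.2
      have hx : (g s - g a) / (g b - g a) ∈ Icc (0 : ℝ) 1 :=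
        ⟨div_nonneg (by linarith) h0.le, by rw [div_le_one h0]; linarith⟩
      refine ⟨_, hx, ?_⟩
      rw [hζ _ hx, ← hiff, hσ2]
      simp only [div_mul_cancel₀ _ h0.ne']
      ring

open Filter Topology in
lemma LS_core {H G : ℝ × ℝ → ℝ} {M δ ρ : ℝ} (hH : LSNice H M) (hG : Continuous G)
    (hG0 : G (0, 0) = 0) (hδ : 0 < δ) (hρ : 0 < ρ)
    (hm : ∀ τ, LSSol H τ → |τ 0| ≤ ρ → StrictMonoOn (fun η => G (η, τ η)) (Icc (-δ) δ)) :
    ∃ U : Set (ℝ × ℝ), IsCompact U ∧ U ∈ 𝓝 ((0, 0) : ℝ × ℝ) ∧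
      (∀ p ∈ U, |p.1| ≤ δ ∧ |p.2| ≤ ρ + M * δ) ∧
      ∃ ζ : ℝ → ℝ × ℝ, ContinuousOn ζ (Icc 0 1) ∧ InjOn ζ (Icc 0 1) ∧
        ζ '' Icc 0 1 = U ∩ {p : ℝ × ℝ | G p = 0} := by
  have hl : -δ ∈ Icc (-δ) δ := ⟨le_rfl, by linarith⟩
  have hr : δ ∈ Icc (-δ) δ := ⟨by linarith, le_rfl⟩
  have hz : (0 : ℝ) ∈ Icc (-δ) δ := ⟨by linarith, by linarith⟩
  -- uniform signs at the ends
  obtain ⟨ε, hε, hερ, hsign⟩ : ∃ ε > 0, ε ≤ ρ ∧ ∀ τ, LSSol H τ → |τ 0| ≤ ε →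
      G (-δ, τ (-δ)) < 0 ∧ 0 < G (δ, τ δ) := by
    let K : Set (ℝ → ℝ) := {τ | LSSol H τ} ∩
      Icc (fun η => -(ρ + M * |η|)) (fun η => ρ + M * |η|)
    have hK : IsCompact K := (isCompact_Icc).inter_left (LSSol_isClosed hH)
    let B : Set (ℝ → ℝ) := K ∩ ({τ | |τ 0| ≤ ρ} ∩ ({τ | 0 ≤ G (-δ, τ (-δ))} ∪ {τ | G (δ, τ δ) ≤ 0}))
    have hB : IsCompact B := hK.inter_right
      ((isClosed_le (by fun_prop) (by fun_prop)).inter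
      ((isClosed_le (by fun_prop) (by fun_prop)).union (isClosed_le (by fun_prop) (by fun_prop))))
    have hI : IsCompact ((fun τ : ℝ → ℝ => τ 0) '' B) := hB.image (continuous_apply 0)
    have h0I : (0 : ℝ) ∉ (fun τ : ℝ → ℝ => τ 0) '' B := by
      rintro ⟨τ, ⟨hK', h1, h2⟩, h0⟩
      simp only at h0
      have hmon := hm τ hK'.1 h1
      rcases h2 with h2 | h2
      · have := hmon hl hz (by linarith)
        simp only [h0, hG0] at this
        exact absurd h2 (not_le.2 this)
      · have := hmon hz hr (by linarith)
        simp only [h0, hG0] at this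
        exact absurd h2 (not_le.2 this)
    obtain ⟨e, he, hball⟩ := Metric.isOpen_iff.1 hI.isClosed.isOpen_compl 0 h0I
    refine ⟨min ρ (e / 2), by positivity, min_le_left _ _, fun τ hτ h => ?_⟩
    have h1 : |τ 0| ≤ ρ := h.trans (min_le_left _ _)
    have h2 : |τ 0| ≤ e / 2 := h.trans (min_le_right _ _)
    by_contra hcon
    refine hball (a := τ 0) (by rw [Metric.mem_ball, Real.dist_eq, sub_zero]; linarith)
      ⟨τ, ⟨⟨hτ, ?_⟩, h1, ?_⟩, rfl⟩
    · have : ∀ η, |τ η| ≤ ρ + M * |η| := fun η => by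
        have h3 := hτ.lip hH 0 η
        rw [sub_zero] at h3
        have : |τ η| ≤ |τ η - τ 0| + |τ 0| := by
          simpa using abs_add_le (τ η - τ 0) (τ 0)
        linarith
      exact ⟨fun η => (abs_le.1 (this η)).1, fun η => (abs_le.1 (this η)).2⟩
    · by_contra hh
      apply hcon
      simp only [mem_union, mem_ofPred_eq, not_or, not_le] at hh
      exact hh
  -- extreme solutions
  obtain ⟨g, hg0, hg⟩ := LS_peano hH 0 ε
  obtain ⟨f', hf'0, hf'⟩ := LS_peano hH 0 (-ε)
  let f : ℝ → ℝ := fun t => min (f' t) (g t)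
  have hf : LSSol H f := hf'.min hg
  have hfg : f ≤ g := fun t => min_le_right _ _
  have hf0 : f 0 = -ε := by simp only [f, hf'0, hg0]; rw [min_eq_left]; linarith
  obtain ⟨T, a, b, hab, hT, hTm, hTc, hTa, hTb, hTfg⟩ := LS_family hH hf hg hfg
  have hbd0 : ∀ τ : ℝ → ℝ, f ≤ τ → τ ≤ g → |τ 0| ≤ ε := fun τ h1 h2 => by
    have h1 := h1 0
    have h2 := h2 0
    rw [abs_le]; constructor <;> linarith
  have hTm' : ∀ s, StrictMonoOn (fun η => G (η, T s η)) (Icc (-δ) δ) := fun s =>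
    hm _ (hT s) ((hbd0 _ (hTfg s).1 (hTfg s).2).trans hερ)
  have hTs := fun s => hsign _ (hT s) (hbd0 _ (hTfg s).1 (hTfg s).2)
  have hzero : ∀ s, ∃ η ∈ Icc (-δ) δ, G (η, T s η) = 0 := fun s => by
    have hc : ContinuousOn (fun η => G (η, T s η)) (Icc (-δ) δ) := by
      have := (hT s).continuous
      fun_prop
    obtain ⟨η, h1, h2⟩ := intermediate_value_Icc (by linarith) hc
      (show (0 : ℝ) ∈ Icc _ _ from ⟨(hTs s).1.le, (hTs s).2.le⟩)
    exact ⟨η, h1, h2⟩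
  choose e he1 he2 using hzero
  have huniq : ∀ s η, η ∈ Icc (-δ) δ → G (η, T s η) = 0 → e s = η := fun s η h1 h2 =>
    (hTm' s).injOn (he1 s) h1 (by simp only [he2, h2])
  have hinner : ∀ s, -δ < e s ∧ e s < δ := fun s => by
    constructor
    · refine lt_of_le_of_ne (he1 s).1 fun h => ?_
      have := he2 s
      rw [← h] at this
      linarith [(hTs s).1]
    · refine lt_of_le_of_ne (he1 s).2 fun h => ?_
      have := he2 s
      rw [h] at this
      linarith [(hTs s).2]
  have hGT : ∀ η, Continuous fun s => G (η, T s η) := fun η => by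
    have := hTc η
    fun_prop
  have hec : Continuous e := by
    rw [continuous_iff_continuousAt]
    intro s
    rw [ContinuousAt, tendsto_order]
    constructor
    · intro c hc
      by_cases hcδ : -δ ≤ c
      · have hcm : c ∈ Icc (-δ) δ := ⟨hcδ, by linarith [(hinner s).2]⟩
        have h1 : G (c, T s c) < 0 := by
          have := hTm' s hcm (he1 s) hc
          simpa only [he2] using this
        filter_upwards [(hGT c).continuousAt.eventually_lt continuousAt_const h1] with t ht
        by_contra hcon
        have := (hTm' t).monotoneOn (he1 t) hcm (not_lt.1 hcon)
        simp only [he2] at this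
        linarith
      · exact Eventually.of_forall fun t => by linarith [(he1 t).1]
    · intro c hc
      by_cases hcδ : c ≤ δ
      · have hcm : c ∈ Icc (-δ) δ := ⟨by linarith [(hinner s).1], hcδ⟩
        have h1 : 0 < G (c, T s c) := by
          have := hTm' s (he1 s) hcm hc
          simpa only [he2] using this
        filter_upwards [continuousAt_const.eventually_lt (hGT c).continuousAt h1] with t ht
        by_contra hcon
        have := (hTm' t).monotoneOn hcm (he1 t) (not_lt.1 hcon)
        simp only [he2] at this
        linarith
      · exact Eventually.of_forall fun t => by linarith [(he1 t).2]
  have hjoint : Continuous fun p : ℝ × ℝ => T p.1 p.2 := by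
    refine continuous_prod_of_continuous_lipschitzWith' _ (Real.toNNReal M) (fun s => ?_)
      (fun η => hTc η)
    refine LipschitzWith.of_dist_le_mul fun x y => ?_
    rw [Real.dist_eq, Real.dist_eq, Real.coe_toNNReal _ hH.1]
    exact (hT s).lip hH y x
  let P : ℝ → ℝ × ℝ := fun s => (e s, T s (e s))
  have hP : Continuous P := hec.prodMk (hjoint.comp (continuous_id.prodMk hec))
  have hPof : ∀ s η y, η ∈ Icc (-δ) δ → T s η = y → G (η, y) = 0 → P s = (η, y) := by
    intro s η y h1 h2 h3
    subst h2
    have := huniq s η h1 h3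
    simp only [P, this]
  have hfib : ∀ s t, P s = P t → ∀ r, s ≤ r → r ≤ t → P r = P s := by
    intro s t hst r h1 h2
    refine hPof r (e s) (T s (e s)) (he1 s) ?_ (he2 s)
    obtain ⟨k1, k2⟩ := Prod.ext_iff.1 hst
    simp only [P] at k1 k2
    refine le_antisymm ?_ (hTm h1 _)
    rw [k2, ← k1]
    exact hTm h2 _
  have hne : P a ≠ P b := by
    intro hcon
    obtain ⟨k1, k2⟩ := Prod.ext_iff.1 hcon
    simp only [P, hTa, hTb] at k1 k2
    obtain ⟨σ, hσ0, hσ⟩ := LS_peano hH 0 0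
    let w : ℝ → ℝ := fun t => max (f t) (min (g t) (σ t))
    have hw : LSSol H w := hf.max (hg.min hσ)
    have hw1 : f ≤ w := fun t => le_max_left _ _
    have hw2 : w ≤ g := fun t => max_le (hfg t) (min_le_left _ _)
    have hw0 : w 0 = 0 := by
      simp only [w, hf0, hg0, hσ0]
      rw [min_eq_right hε.le, max_eq_right (by linarith)]
    have hwe : w (e a) = f (e a) := by
      refine le_antisymm ?_ (hw1 _)
      rw [k2, ← k1]
      exact hw2 _
    have hGe := he2 a
    rw [hTa] at hGe
    have hmon := hm w hw ((hbd0 w hw1 hw2).trans hερ)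
    have h00 : e a = 0 := hmon.injOn (he1 a) hz (by simp only [hwe, hGe, hw0, hG0])
    rw [← k1, h00, hf0, hg0] at k2
    linarith
  obtain ⟨ζ, hζ1, hζ2, hζ3⟩ := LS_arc hP hab hfib hne
  have hfc := hf.continuous
  have hgc := hg.continuous
  have hbound : ∀ η y, |η| ≤ δ → f η ≤ y → y ≤ g η → |y| ≤ ρ + M * δ := by
    intro η y h1 h2 h3
    have k1 := hf.lip hH 0 η
    have k2 := hg.lip hH 0 η
    have k3 : M * |η| ≤ M * δ := mul_le_mul_of_nonneg_left h1 hH.1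
    rw [sub_zero, abs_le] at k1 k2
    rw [abs_le]
    constructor <;> linarith [k1.1, k2.2]
  let U : Set (ℝ × ℝ) := {p | |p.1| ≤ δ ∧ f p.1 ≤ p.2 ∧ p.2 ≤ g p.1}
  refine ⟨U, ?_, ?_, fun p hp => ⟨hp.1, hbound _ _ hp.1 hp.2.1 hp.2.2⟩, ζ, hζ1, hζ2, ?_⟩
  · have c1 : IsClosed {p : ℝ × ℝ | |p.1| ≤ δ} := isClosed_le (by fun_prop) (by fun_prop)
    have c2 : IsClosed {p : ℝ × ℝ | f p.1 ≤ p.2} := isClosed_le (by fun_prop) (by fun_prop)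
    have c3 : IsClosed {p : ℝ × ℝ | p.2 ≤ g p.1} := isClosed_le (by fun_prop) (by fun_prop)
    have hcl : IsClosed U := c1.inter (c2.inter c3)
    refine IsCompact.of_isClosed_subset ((isCompact_Icc (a := -δ) (b := δ)).prod
      (isCompact_Icc (a := -(ρ + M * δ)) (b := ρ + M * δ))) hcl fun p hp => ?_
    exact ⟨abs_le.1 hp.1, abs_le.1 (hbound _ _ hp.1 hp.2.1 hp.2.2)⟩
  · have c1 : IsOpen {p : ℝ × ℝ | |p.1| < δ} := isOpen_lt (by fun_prop) (by fun_prop)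
    have c2 : IsOpen {p : ℝ × ℝ | f p.1 < p.2} := isOpen_lt (by fun_prop) (by fun_prop)
    have c3 : IsOpen {p : ℝ × ℝ | p.2 < g p.1} := isOpen_lt (by fun_prop) (by fun_prop)
    have hop : IsOpen {p : ℝ × ℝ | |p.1| < δ ∧ f p.1 < p.2 ∧ p.2 < g p.1} :=
      c1.inter (c2.inter c3)
    refine mem_of_superset (hop.mem_nhds ?_) fun p hp => ⟨hp.1.le, hp.2.1.le, hp.2.2.le⟩
    refine ⟨by simpa using hδ, ?_, ?_⟩
    · simp only [hf0]; linarith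
    · simp only [hg0]; exact hε
  · rw [hζ3]
    ext ⟨η, y⟩
    constructor
    · rintro ⟨s, -, hs⟩
      rw [← hs]
      exact ⟨⟨abs_le.2 (he1 s), (hTfg s).1 _, (hTfg s).2 _⟩, he2 s⟩
    · rintro ⟨⟨h1, h2, h3⟩, h4⟩
      obtain ⟨s, hs, hsy⟩ := intermediate_value_Icc hab (hTc η).continuousOn
        (show y ∈ Icc _ _ from ⟨by rw [hTa]; exact h2, by rw [hTb]; exact h3⟩)
      exact ⟨s, hs, hPof s η y (abs_le.1 h1) hsy h4⟩

/-- **Theorem 4.1 (level sets via monotone flows).** Let `A ⊆ ℝ²` be open with `(0,0) ∈ A`,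
let `h : A → ℝ` and `F : A → ℝ` be continuous with `F (0,0) = 0`. Assume that every solution
`τ` of `τ̇ η = h (η, τ η)` on a compact interval, whose graph is contained in `A`, makes
`η ↦ F (η, τ η)` strictly increasing. Then there exist a compact neighbourhood `U ⊆ A` of the
origin and an injective continuous curve `ζ : [0,1] → U` with `ζ([0,1]) = U ∩ F⁻¹(0)`. -/
theorem level_set_is_injective_curve
    (A : Set (ℝ × ℝ)) (hA : IsOpen A) (h0 : ((0, 0) : ℝ × ℝ) ∈ A)
    (h : ℝ × ℝ → ℝ) (hh : ContinuousOn h A)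
    (F : ℝ × ℝ → ℝ) (hF : ContinuousOn F A) (hF0 : F (0, 0) = 0)
    (hmono : ∀ (a b : ℝ), a ≤ b → ∀ τ : ℝ → ℝ, IsODESolOn A h (Set.Icc a b) τ →
      StrictMonoOn (fun η => F (η, τ η)) (Set.Icc a b)) :
    ∃ U : Set (ℝ × ℝ), IsCompact U ∧ U ∈ nhds ((0, 0) : ℝ × ℝ) ∧ U ⊆ A ∧
      ∃ ζ : ℝ → ℝ × ℝ, ContinuousOn ζ (Set.Icc 0 1) ∧ Set.InjOn ζ (Set.Icc 0 1) ∧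
        Set.MapsTo ζ (Set.Icc 0 1) U ∧
        ζ '' Set.Icc 0 1 = U ∩ {p : ℝ × ℝ | F p = 0} := by
  obtain ⟨r, hr, hball⟩ := Metric.nhds_basis_closedBall.mem_iff.1 (hA.mem_nhds h0)
  let B : Set (ℝ × ℝ) := Icc (-r) r ×ˢ Icc (-r) r
  have hB : IsCompact B := isCompact_Icc.prod isCompact_Icc
  have hBA : B ⊆ A := by
    intro p hp
    apply hball
    rw [Metric.mem_closedBall, Prod.dist_eq, Real.dist_eq, Real.dist_eq]
    simp only [sub_zero]
    exact max_le (abs_le.2 hp.1) (abs_le.2 hp.2)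
  obtain ⟨M', hM'⟩ := hB.exists_bound_of_continuousOn (hh.mono hBA)
  set M : ℝ := max M' 0 with hMdef
  have hM0 : 0 ≤ M := le_max_right _ _
  have hrr : -r ≤ r := by linarith
  let c : ℝ → ℝ := fun x => (projIcc (-r) r hrr x : ℝ)
  have hcc : Continuous c := continuous_subtype_val.comp continuous_projIcc
  have hcm : ∀ x, c x ∈ Icc (-r) r := fun x => (projIcc (-r) r hrr x).2
  have hcl : ∀ x y, |c x - c y| ≤ |x - y| := fun x y => by
    have := (LipschitzWith.projIcc hrr).dist_le_mul x y
    simpa [Subtype.dist_eq, Real.dist_eq] using this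
  have hcid : ∀ x, |x| ≤ r → c x = x := fun x hx => by
    simp only [c, projIcc_of_mem hrr (abs_le.1 hx)]
  let κ : ℝ × ℝ → ℝ × ℝ := fun p => (c p.1, c p.2)
  have hκ : Continuous κ := by fun_prop
  have hκB : ∀ p, κ p ∈ B := fun p => ⟨hcm _, hcm _⟩
  have hκid : ∀ p : ℝ × ℝ, |p.1| ≤ r → |p.2| ≤ r → κ p = p := fun p h1 h2 =>
    Prod.ext (hcid _ h1) (hcid _ h2)
  have hHnice : LSNice (fun p => h (κ p)) M := by
    refine ⟨hM0, fun p => (hM' _ (hκB p)).trans (le_max_left _ _),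
      (hh.mono hBA).comp_continuous hκ hκB, fun ε hε => ?_⟩
    have huc := hB.uniformContinuousOn_of_continuous (hh.mono hBA)
    obtain ⟨d, hd0, hd⟩ := Metric.uniformContinuousOn_iff.1 huc ε hε
    refine ⟨d / (M + 1), by positivity, fun a b y z h1 h2 => ?_⟩
    rw [lt_div_iff₀ (by positivity)] at h1
    have h3 := hd (κ (a, y)) (hκB _) (κ (b, z)) (hκB _) (by
      rw [Prod.dist_eq, Real.dist_eq, Real.dist_eq]
      have k1 := hcl a b
      have k2 := hcl y z
      have k3 := abs_nonneg (a - b)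
      refine max_lt ?_ ?_
      · simp only [κ]; nlinarith
      · simp only [κ]; nlinarith)
    rw [Real.dist_eq] at h3
    exact h3.le
  have hGc : Continuous fun p => F (κ p) := (hF.mono hBA).comp_continuous hκ hκB
  have hκ0 : κ (0, 0) = (0, 0) := hκid _ (by simpa using hr.le) (by simpa using hr.le)
  set δ : ℝ := min r (r / (2 * (M + 1))) with hδdef
  have hδ : 0 < δ := by positivity
  have hδr : δ ≤ r := min_le_left _ _
  have hδM : M * δ ≤ r / 2 := by
    have h1 : δ ≤ r / (2 * (M + 1)) := min_le_right _ _
    rw [le_div_iff₀ (by positivity)] at h1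
    nlinarith
  obtain ⟨U, hU1, hU2, hU3, ζ, hζ1, hζ2, hζ3⟩ := LS_core (H := fun p => h (κ p))
    (G := fun p => F (κ p)) (δ := δ) (ρ := r / 2) hHnice hGc (by simp only [hκ0, hF0]) hδ
    (by positivity) (by
      intro τ hτ hτ0
      have hbox : ∀ η ∈ Icc (-δ) δ, |η| ≤ r ∧ |τ η| ≤ r := by
        intro η hη
        have h1 : |η| ≤ δ := abs_le.2 hη
        have h2 := hτ.lip hHnice 0 η
        rw [sub_zero] at h2
        have h3 : |τ η| ≤ |τ η - τ 0| + |τ 0| := by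
          simpa using abs_add_le (τ η - τ 0) (τ 0)
        have h4 : M * |η| ≤ M * δ := mul_le_mul_of_nonneg_left h1 hM0
        exact ⟨h1.trans hδr, by linarith⟩
      have hκη : ∀ η ∈ Icc (-δ) δ, κ (η, τ η) = (η, τ η) := fun η hη =>
        hκid _ (hbox η hη).1 (hbox η hη).2
      have hsol : IsODESolOn A h (Icc (-δ) δ) τ := by
        refine ⟨fun η hη => ?_, fun η hη => ?_⟩
        · rw [← hκη η hη]; exact hBA (hκB _)
        · have := hτ η
          simp only [hκη η hη] at this
          exact this.hasDerivWithinAt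
      have hs := hmono (-δ) δ (by linarith) τ hsol
      exact hs.congr fun η hη => by simp only [hκη η hη])
  have hUbox : ∀ p ∈ U, κ p = p := fun p hp =>
    hκid p ((hU3 p hp).1.trans hδr) (by linarith [(hU3 p hp).2])
  have hset : U ∩ {p : ℝ × ℝ | F (κ p) = 0} = U ∩ {p : ℝ × ℝ | F p = 0} := by
    ext p
    constructor
    · rintro ⟨h1, h2⟩
      refine ⟨h1, ?_⟩
      have h2 : F (κ p) = 0 := h2
      rwa [hUbox p h1] at h2
    · rintro ⟨h1, h2⟩
      refine ⟨h1, ?_⟩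
      change F (κ p) = 0
      rw [hUbox p h1]
      exact h2
  rw [hset] at hζ3
  refine ⟨U, hU1, hU2, fun p hp => by rw [← hUbox p hp]; exact hBA (hκB p), ζ, hζ1, hζ2,
    fun x hx => ?_, hζ3⟩
  have : ζ x ∈ ζ '' Icc 0 1 := mem_image_of_mem _ hx
  rw [hζ3] at this
  exact this.1
end
end

section
/- Let A ⊂ ℝ² be open, let h: A → ℝ be continuous, let I and J be compact intervals with I×J ⊂ A, and let τ₁, τ₂ be two solutions of the ODE τ̇(η) = h(η,τ(η)) on I with graphs contained in I×J and τ₁ ≤ τ₂ on I. Then the set 𝔗(τ₁,τ₂) = { τ : τ is a solution of the ODE on I with τ₁ ≤ τ ≤ τ₂ on I } is a connected subset of the space C(I,ℝ) equipped with the sup norm. -/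
noncomputable section

open Set

open MeasureTheory Filter Topology

lemma aux_compact (a b M R : ℝ) :
    IsCompact {u : C(Icc a b, ℝ) | (∀ t, |u t| ≤ R) ∧ ∀ s t, |u s - u t| ≤ M * |(s : ℝ) - t|} := by
  apply ArzelaAscoli.isCompact_of_equicontinuous
  · have himg : (ContinuousMap.toFun '' {u : C(Icc a b, ℝ) | (∀ t, |u t| ≤ R) ∧
        ∀ s t, |u s - u t| ≤ M * |(s : ℝ) - t|}) =
        {f : Icc a b → ℝ | (∀ t, |f t| ≤ R) ∧ ∀ s t, |f s - f t| ≤ M * |(s : ℝ) - t|} := by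
      ext f
      constructor
      · rintro ⟨u, hu, rfl⟩
        exact hu
      · intro hf
        have hfc : Continuous f := by
          have : LipschitzWith (Real.toNNReal M) f := by
            apply LipschitzWith.of_dist_le_mul
            intro s t
            rw [Real.dist_eq, Subtype.dist_eq, Real.dist_eq]
            refine (hf.2 s t).trans ?_
            gcongr
            exact Real.le_coe_toNNReal M
          exact this.continuous
        exact ⟨⟨f, hfc⟩, hf, rfl⟩
    rw [himg]
    refine IsCompact.of_isClosed_subset
      (isCompact_univ_pi (fun _ : Icc a b => isCompact_Icc (a := -R) (b := R))) ?_ ?_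
    · simp only [ofPred_and, ofPred_forall]
      refine IsClosed.inter ?_ ?_
      · exact isClosed_iInter fun t => isClosed_le (by fun_prop) (by fun_prop)
      · exact isClosed_iInter fun t => isClosed_iInter fun s =>
          isClosed_le (by fun_prop) (by fun_prop)
    · intro f hf t _
      exact abs_le.1 (hf.1 t)
  · apply Metric.equicontinuous_of_continuity_modulus (fun r => |M| * r)
    · have : Tendsto (fun r : ℝ => |M| * r) (𝓝 0) (𝓝 (|M| * 0)) :=
        (continuous_const.mul continuous_id).tendsto 0
      simpa using this
    · rintro s t ⟨u, hu⟩
      rw [Real.dist_eq, Subtype.dist_eq, Real.dist_eq]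
      refine (hu.2 s t).trans ?_
      gcongr
      exact le_abs_self M

lemma aux_lip (g : ℝ → ℝ) (hg : Continuous g) (M : ℝ) (hM : ∀ x, |g x| ≤ M) (x y : ℝ)
    (ε : ℝ) (hε : 0 < ε) :
    |(∫ s in (0:ℝ)..1, g (x + ε * s)) - ∫ s in (0:ℝ)..1, g (y + ε * s)|
      ≤ ε⁻¹ * (2 * M) * |x - y| := by
  have e : ∀ x, ∫ s in (0:ℝ)..1, g (x + ε * s) = ε⁻¹ * ∫ s in x..x + ε, g s := by
    intro x
    rw [intervalIntegral.integral_comp_add_mul g hε.ne' x]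
    simp
  have hi : ∀ u v, IntervalIntegrable g volume u v := fun u v => hg.intervalIntegrable u v
  rw [e, e, ← mul_sub, intervalIntegral.integral_interval_sub_interval_comm (hi _ _) (hi _ _)
    (hi _ _), abs_mul, abs_of_pos (inv_pos.2 hε), mul_assoc]
  gcongr
  have b1 := intervalIntegral.norm_integral_le_of_norm_le_const (a := x) (b := y) (f := g) (C := M)
    (fun s _ => hM s)
  have b2 := intervalIntegral.norm_integral_le_of_norm_le_const (a := x + ε) (b := y + ε)
    (f := g) (C := M) (fun s _ => hM s)
  rw [Real.norm_eq_abs] at b1 b2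
  rw [abs_sub_comm x y]
  have : y + ε - (x + ε) = y - x := by ring
  rw [this] at b2
  refine (abs_sub _ _).trans ?_
  linarith

lemma aux_picard (a b : ℝ) (hab : a ≤ b) (g : ℝ → ℝ → ℝ) (hg : Continuous (Function.uncurry g))
    (M : ℝ) (hM : ∀ t x, |g t x| ≤ M) (K : ℝ) (hK : ∀ t x y, |g t x - g t y| ≤ K * |x - y|)
    (t₀ : Icc a b) (x₀ : ℝ) :
    ∃ u : C(Icc a b, ℝ), ∀ t : Icc a b,
      u t = x₀ + ∫ s in (t₀ : ℝ)..t, g s (u (projIcc a b hab s)) := by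
  have hM0 : 0 ≤ M := (abs_nonneg _).trans (hM 0 0)
  have hpl : IsPicardLindelof g t₀ x₀ (Real.toNNReal (M * (b - a))) 0 (Real.toNNReal M)
      (Real.toNNReal K) := by
    refine ⟨?_, ?_, ?_, ?_⟩
    · intro t _
      apply LipschitzWith.lipschitzOnWith
      apply LipschitzWith.of_dist_le_mul
      intro x y
      rw [Real.dist_eq, Real.dist_eq]
      refine (hK t x y).trans ?_
      gcongr
      exact Real.le_coe_toNNReal K
    · intro x _
      exact (hg.comp (by fun_prop : Continuous fun t : ℝ => (t, x))).continuousOn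
    · intro t _ x _
      exact (hM t x).trans (Real.le_coe_toNNReal M)
    · have h1 := t₀.2.1
      have h2 := t₀.2.2
      rw [Real.coe_toNNReal _ hM0, Real.coe_toNNReal _ (mul_nonneg hM0 (by linarith))]
      simp only [NNReal.coe_zero, sub_zero]
      gcongr
      exact max_le (by linarith) (by linarith)
  obtain ⟨α, hα⟩ := ODE.FunSpace.exists_isFixedPt_next hpl (x := x₀) (by simp)
  refine ⟨⟨α, α.continuous⟩, fun t => ?_⟩
  have := congrArg (fun β => β t) hα
  simp only [ODE.FunSpace.next_apply, ODE.picard_apply] at this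
  exact this.symm

lemma aux_peano (a b : ℝ) (hab : a ≤ b) (g : ℝ → ℝ → ℝ) (hg : Continuous (Function.uncurry g))
    (M : ℝ) (hM : ∀ t x, |g t x| ≤ M)
    (t₀ : Icc a b) (x₀ : ℝ) :
    ∃ u : C(Icc a b, ℝ), ∀ t : Icc a b,
      u t = x₀ + ∫ s in (t₀ : ℝ)..t, g s (u (projIcc a b hab s)) := by
  have hM0 : 0 ≤ M := (abs_nonneg _).trans (hM 0 0)
  let G : ℝ → ℝ → ℝ → ℝ := fun ε t x => ∫ s in (0:ℝ)..1, g t (x + ε * s)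
  have hGc : Continuous (fun p : ℝ × ℝ × ℝ => G p.1 p.2.1 p.2.2) := by
    apply intervalIntegral.continuous_parametric_intervalIntegral_of_continuous'
    exact hg.comp (by fun_prop :
      Continuous fun q : (ℝ × ℝ × ℝ) × ℝ => (q.1.2.1, q.1.2.2 + q.1.1 * q.2))
  have hG0 : ∀ t x, G 0 t x = g t x := by
    intro t x
    simp [G]
  have hGM : ∀ ε t x, |G ε t x| ≤ M := by
    intro ε t x
    have := intervalIntegral.norm_integral_le_of_norm_le_const (a := 0) (b := 1)
      (f := fun s => g t (x + ε * s)) (C := M) (fun s _ => hM t _)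
    simpa using this
  let R : ℝ := |x₀| + M * (b - a)
  let K := {u : C(Icc a b, ℝ) | (∀ t, |u t| ≤ R) ∧ ∀ s t, |u s - u t| ≤ M * |(s : ℝ) - t|}
  have hK : IsCompact K := aux_compact a b M R
  let S : Set (C(Icc a b, ℝ) × ℝ) := {p | ∀ t : Icc a b,
      p.1 t = x₀ + ∫ s in (t₀ : ℝ)..t, G p.2 s (p.1 (projIcc a b hab s))}
  have hS : IsClosed S := by
    simp only [S, ofPred_forall]
    refine isClosed_iInter fun t => isClosed_eq (by fun_prop) ?_
    refine continuous_const.add ?_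
    apply intervalIntegral.continuous_parametric_intervalIntegral_of_continuous'
    refine hGc.comp (f := fun q : (C(Icc a b, ℝ) × ℝ) × ℝ =>
      (q.1.2, q.2, q.1.1 (projIcc a b hab q.2))) ?_
    have hp : Continuous (projIcc a b hab) := continuous_projIcc
    fun_prop
  have hSK : ∀ p ∈ S, p.1 ∈ K := by
    rintro ⟨u, ε⟩ hp
    have hcont : Continuous fun s => G ε s (u (projIcc a b hab s)) := by
      refine hGc.comp (f := fun s : ℝ => (ε, s, u (projIcc a b hab s))) ?_
      have hp : Continuous (projIcc a b hab) := continuous_projIcc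
      fun_prop
    constructor
    · intro t
      simp only
      rw [hp t]
      refine (abs_add_le _ _).trans ?_
      simp only [R]
      gcongr
      have := intervalIntegral.norm_integral_le_of_norm_le_const (a := (t₀ : ℝ)) (b := t)
        (f := fun s => G ε s (u (projIcc a b hab s))) (C := M) (fun s _ => hGM _ _ _)
      refine this.trans ?_
      gcongr
      have h1 := t.2.1
      have h2 := t.2.2
      have h3 := t₀.2.1
      have h4 := t₀.2.2
      rw [abs_le]
      constructor <;> linarith
    · intro s t
      simp only
      rw [hp s, hp t, add_sub_add_left_eq_sub, intervalIntegral.integral_interval_sub_left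
        (hcont.intervalIntegrable _ _) (hcont.intervalIntegrable _ _)]
      exact intervalIntegral.norm_integral_le_of_norm_le_const (a := (t : ℝ)) (b := s)
        (f := fun s => G ε s (u (projIcc a b hab s))) (C := M) (fun s _ => hGM _ _ _)
  have hpos : ∀ ε : ℝ, 0 < ε → ∃ u, (u, ε) ∈ S := by
    intro ε hε
    refine aux_picard a b hab (G ε) ?_ M (hGM ε) (ε⁻¹ * (2 * M)) ?_ t₀ x₀
    · exact hGc.comp (by fun_prop : Continuous fun q : ℝ × ℝ => (ε, q.1, q.2))
    · intro t x y
      exact aux_lip (g t) (hg.comp (by fun_prop : Continuous fun x : ℝ => (t, x))) M (hM t) x y ε hε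
  let u : ℕ → C(Icc a b, ℝ) := fun n => (hpos (1 / ((n : ℝ) + 1)) (by positivity)).choose
  have hu : ∀ n, (u n, 1 / ((n : ℝ) + 1)) ∈ S := fun n =>
    (hpos (1 / ((n : ℝ) + 1)) (by positivity)).choose_spec
  obtain ⟨v, -, φ, hφ, hv⟩ := hK.tendsto_subseq (fun n => hSK _ (hu n))
  have hlim : (v, (0 : ℝ)) ∈ S := by
    refine hS.mem_of_tendsto (hv.prodMk_nhds
      ((tendsto_one_div_add_atTop_nhds_zero_nat (𝕜 := ℝ)).comp hφ.tendsto_atTop))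
      (Eventually.of_forall fun n => hu (φ n))
  refine ⟨v, fun t => ?_⟩
  have := hlim t
  simp only [hG0] at this
  exact this

lemma aux_sq (x : ℝ) : HasDerivAt (fun y : ℝ => (max y 0) ^ 2) (2 * max x 0) x := by
  rcases lt_trichotomy x 0 with hx | hx | hx
  · have : (fun y : ℝ => (max y 0) ^ 2) =ᶠ[𝓝 x] fun _ => 0 := by
      filter_upwards [Iio_mem_nhds hx] with y hy
      rw [max_eq_right (le_of_lt hy)]; simp
    rw [max_eq_right hx.le, mul_zero]
    exact (hasDerivAt_const x (0:ℝ)).congr_of_eventuallyEq this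
  · subst hx
    simp only [max_self, mul_zero]
    rw [hasDerivAt_iff_isLittleO]
    simp only [max_self, sub_zero, smul_zero]
    have h2 : (fun y : ℝ => y ^ 2) =o[𝓝 0] fun y => y := by
      simpa using Asymptotics.isLittleO_pow_pow (𝕜 := ℝ) (m := 1) (n := 2) (by norm_num)
    refine Asymptotics.IsBigO.trans_isLittleO ?_ h2
    refine Asymptotics.IsBigO.of_bound 1 (Eventually.of_forall fun y => ?_)
    simp only [Real.norm_eq_abs, abs_pow, one_mul, ne_eq, OfNat.ofNat_ne_zero, not_false_eq_true,
      zero_pow, sub_zero]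
    refine pow_le_pow_left₀ (abs_nonneg _) ?_ 2
    rcases le_total y 0 with h | h <;> simp [h]
  · have : (fun y : ℝ => (max y 0) ^ 2) =ᶠ[𝓝 x] fun y => y ^ 2 := by
      filter_upwards [Ioi_mem_nhds hx] with y hy
      rw [max_eq_left (le_of_lt hy)]
    rw [max_eq_left hx.le]
    have h2 := (hasDerivAt_pow 2 x).congr_of_eventuallyEq this
    simpa using h2

/-- If `f` is nonpositive at one point and stationary wherever it is positive, it is nonpositive. -/
lemma aux_nonpos (a b : ℝ) (f f' : ℝ → ℝ) (hf : ∀ t ∈ Icc a b, HasDerivWithinAt f (f' t) (Icc a b) t)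
    (h0 : ∀ t ∈ Icc a b, 0 < f t → f' t = 0) (t₀ : ℝ) (ht₀ : t₀ ∈ Icc a b) (hft : f t₀ ≤ 0) :
    ∀ t ∈ Icc a b, f t ≤ 0 := by
  intro t ht
  have hd : ∀ t ∈ Icc a b, HasDerivWithinAt (fun t => (max (f t) 0) ^ 2) 0 (Icc a b) t := by
    intro t ht
    have := (aux_sq (f t)).comp_hasDerivWithinAt t (hf t ht)
    have h2 : 2 * max (f t) 0 * f' t = 0 := by
      rcases le_or_gt (f t) 0 with h | h
      · simp [h]
      · simp [h0 t ht h]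
    rw [h2] at this
    exact this
  have := (convex_Icc a b).norm_image_sub_le_of_norm_hasDerivWithin_le (C := 0) hd
    (by simp) ht₀ ht
  simp only [max_eq_right hft, zero_mul] at this
  have h3 : max (f t) 0 = 0 := by
    simpa using this
  exact max_eq_right_iff.1 h3

lemma aux_closed_le (a b : ℝ) : IsClosed {x : C(Icc a b, ℝ) × C(Icc a b, ℝ) | x.1 ≤ x.2} := by
  have : {x : C(Icc a b, ℝ) × C(Icc a b, ℝ) | x.1 ≤ x.2} = ⋂ t : Icc a b, {x | x.1 t ≤ x.2 t} := by
    ext x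
    simp [ContinuousMap.le_def]
  rw [this]
  exact isClosed_iInter fun t => isClosed_le (by fun_prop) (by fun_prop)

lemma aux_functional (a b : ℝ) (hab : a ≤ b) : ∃ m : C(Icc a b, ℝ) → ℝ, Continuous m ∧
    ∀ p q : C(Icc a b, ℝ), p ≤ q → p ≠ q → m p < m q := by
  refine ⟨fun u => u ⟨a, left_mem_Icc.2 hab⟩ + ∫ s in a..b, u (projIcc a b hab s), ?_, ?_⟩
  · refine Continuous.add (by fun_prop) ?_
    apply intervalIntegral.continuous_parametric_intervalIntegral_of_continuous'
    have hp : Continuous (projIcc a b hab) := continuous_projIcc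
    simp only [Function.uncurry_def]
    fun_prop
  · intro p q hpq hne
    have hp : Continuous (projIcc a b hab) := continuous_projIcc
    obtain ⟨c, hc⟩ : ∃ c, p c ≠ q c := by
      by_contra! h
      exact hne (ContinuousMap.ext h)
    have hc' : p c < q c := lt_of_le_of_ne (hpq c) hc
    rcases hab.lt_or_eq with hlt | heq
    · refine add_lt_add_of_le_of_lt (hpq _) ?_
      apply intervalIntegral.integral_lt_integral_of_continuousOn_of_le_of_exists_lt hlt
      · fun_prop
      · fun_prop
      · intro x _
        exact hpq _
      · exact ⟨c, c.2, by simpa [projIcc_val] using hc'⟩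
    · subst heq
      have : c = ⟨a, left_mem_Icc.2 hab⟩ := by
        apply Subtype.ext
        exact le_antisymm c.2.2 c.2.1
      subst this
      simpa using hc'

lemma aux_connected (a b : ℝ) (hab : a ≤ b) (T : Set C(Icc a b, ℝ)) (hT : IsCompact T)
    (hbet : ∀ p ∈ T, ∀ q ∈ T, p ≤ q → p ≠ q → ∃ w ∈ T, p ≤ w ∧ w ≤ q ∧ w ≠ p ∧ w ≠ q)
    (top : C(Icc a b, ℝ)) (htop : top ∈ T) (hle : ∀ u ∈ T, u ≤ top) : IsPreconnected T := by
  obtain ⟨m, hm, hmono⟩ := aux_functional a b hab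
  have core : ∀ t t' : Set C(Icc a b, ℝ), IsClosed t → IsClosed t' → T ⊆ t ∪ t' →
      ∀ p₀ ∈ T ∩ t, ∀ q₀ ∈ T ∩ t', p₀ ≤ q₀ → (T ∩ (t ∩ t')).Nonempty := by
    intro t t' ht ht' hcov p₀ hp₀ q₀ hq₀ hpq
    let P : Set (C(Icc a b, ℝ) × C(Icc a b, ℝ)) :=
      ((T ∩ t) ×ˢ (T ∩ t')) ∩ {x | x.1 ≤ x.2}
    have hP : IsCompact P := by
      refine ((hT.inter_right ht).prod (hT.inter_right ht')).inter_right ?_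
      exact aux_closed_le a b
    obtain ⟨⟨p, q⟩, ⟨⟨hp, hq⟩, hle'⟩, hmin⟩ := hP.exists_isMinOn ⟨(p₀, q₀), ⟨hp₀, hq₀⟩, hpq⟩
      (f := fun x => m x.2 - m x.1) (by fun_prop)
    by_cases hne : p = q
    · subst hne
      exact ⟨p, hp.1, hp.2, hq.2⟩
    · obtain ⟨w, hw, hpw, hwq, hwp, hwq'⟩ := hbet p hp.1 q hq.1 hle' hne
      exfalso
      rcases hcov hw with hwt | hwt
      · have h1 : m q - m p ≤ m q - m w := hmin (a := (w, q)) ⟨⟨⟨hw, hwt⟩, hq⟩, hwq⟩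
        have h2 := hmono p w hpw (Ne.symm hwp)
        linarith
      · have h1 : m q - m p ≤ m w - m p := hmin (a := (p, w)) ⟨⟨hp, ⟨hw, hwt⟩⟩, hpw⟩
        have h2 := hmono w q hwq hwq'
        linarith
  rw [isPreconnected_closed_iff]
  rintro t t' ht ht' hcov ⟨x, hx⟩ ⟨y, hy⟩
  rcases hcov htop with h | h
  · have := core t' t ht' ht (by rwa [union_comm]) y hy top ⟨htop, h⟩ (hle y hy.1)
    rwa [inter_comm t' t] at this
  · exact core t t' ht ht' hcov x hx top ⟨htop, h⟩ (hle x hx.1)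

/-- The vector field `h` truncated to the band between `p` and `q`. -/
def clampField (h : ℝ × ℝ → ℝ) (a b : ℝ) (hab : a ≤ b) (p q : C(Icc a b, ℝ)) (t x : ℝ) : ℝ :=
  h (projIcc a b hab t, max (p (projIcc a b hab t)) (min x (q (projIcc a b hab t))))

lemma clamp_mem (a b c d : ℝ) (hab : a ≤ b) (p q : C(Icc a b, ℝ))
    (hpJ : ∀ t, p t ∈ Icc c d) (hqJ : ∀ t, q t ∈ Icc c d) (t x : ℝ) :
    (((projIcc a b hab t : ℝ), max (p (projIcc a b hab t)) (min x (q (projIcc a b hab t)))) : ℝ × ℝ)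
      ∈ Icc a b ×ˢ Icc c d := by
  refine ⟨(projIcc a b hab t).2, ?_, ?_⟩
  · exact (hpJ _).1.trans (le_max_left _ _)
  · exact max_le (hpJ _).2 ((min_le_right _ _).trans (hqJ _).2)

lemma clamp_cont (A : Set (ℝ × ℝ)) (h : ℝ × ℝ → ℝ) (hh : ContinuousOn h A)
    (a b c d : ℝ) (hab : a ≤ b)
    (hIJ : Icc a b ×ˢ Icc c d ⊆ A) (p q : C(Icc a b, ℝ))
    (hpJ : ∀ t, p t ∈ Icc c d) (hqJ : ∀ t, q t ∈ Icc c d)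
    : Continuous (Function.uncurry (clampField h a b hab p q)) := by
  have hp : Continuous (projIcc a b hab) := continuous_projIcc
  refine (hh.mono hIJ).comp_continuous (f := fun z : ℝ × ℝ =>
    ((projIcc a b hab z.1 : ℝ),
      max (p (projIcc a b hab z.1)) (min z.2 (q (projIcc a b hab z.1))))) (by fun_prop) ?_
  intro z
  exact clamp_mem a b c d hab p q hpJ hqJ z.1 z.2

lemma clamp_bdd (A : Set (ℝ × ℝ)) (h : ℝ × ℝ → ℝ) (hh : ContinuousOn h A)
    (a b c d : ℝ) (hab : a ≤ b)
    (hIJ : Icc a b ×ˢ Icc c d ⊆ A) (p q : C(Icc a b, ℝ))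
    (hpJ : ∀ t, p t ∈ Icc c d) (hqJ : ∀ t, q t ∈ Icc c d)
    : ∃ M, ∀ t x, |clampField h a b hab p q t x| ≤ M := by
  obtain ⟨M, hM⟩ := (isCompact_Icc.prod isCompact_Icc).exists_bound_of_continuousOn
    (hh.mono hIJ)
  exact ⟨M, fun t x => hM _ (clamp_mem a b c d hab p q hpJ hqJ t x)⟩

lemma clamp_eq (h : ℝ × ℝ → ℝ) (a b : ℝ) (hab : a ≤ b) (p q : C(Icc a b, ℝ))
    (t : Icc a b) (x : ℝ) (h1 : p t ≤ x) (h2 : x ≤ q t) :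
    clampField h a b hab p q t x = h (t, x) := by
  simp [clampField, projIcc_val, h1, h2]

/-- Solutions in the band satisfy the integral equation of the truncated field. -/
lemma sol_integral (A : Set (ℝ × ℝ)) (h : ℝ × ℝ → ℝ) (a b : ℝ) (hab : a ≤ b) (p q : C(Icc a b, ℝ))
    (hg : Continuous (Function.uncurry (clampField h a b hab p q)))
    (u : C(Icc a b, ℝ)) (hpu : p ≤ u) (huq : u ≤ q) (τ : ℝ → ℝ)
    (hτ : IsODESolOn A h (Icc a b) τ) (huτ : ∀ t : Icc a b, u t = τ t) (t₀ t : Icc a b) :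
    u t = u t₀ + ∫ s in (t₀ : ℝ)..t, clampField h a b hab p q s (u (projIcc a b hab s)) := by
  have hsub : uIcc (t₀ : ℝ) t ⊆ Icc a b := uIcc_subset_Icc t₀.2 t.2
  have key := ODE.picard_eq_of_hasDerivAt (f := clampField h a b hab p q)
    (α := fun s => u (projIcc a b hab s)) (t₀ := (t₀ : ℝ)) (t := (t : ℝ)) (u := univ)
    hg.continuousOn ?_ (fun _ _ => mem_univ _)
  · simp only [ODE.picard_apply, projIcc_val] at key
    exact key.symm
  · intro s hs
    have hs' := hsub hs
    have e : ∀ r ∈ Icc a b, u (projIcc a b hab r) = τ r := by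
      intro r hr
      rw [huτ, projIcc_of_mem hab hr]
    have e2 : clampField h a b hab p q s (u (projIcc a b hab s)) = h (s, τ s) := by
      rw [projIcc_of_mem hab hs', ← e s hs', projIcc_of_mem hab hs']
      exact clamp_eq h a b hab p q ⟨s, hs'⟩ _ (hpu _) (huq _)
    rw [e2]
    exact (((hτ.2 s hs').congr (fun r hr => e r hr) (e s hs')).mono hsub)

/-- Solutions of the truncated integral equation are differentiable. -/
lemma integral_deriv (h : ℝ × ℝ → ℝ) (a b : ℝ) (hab : a ≤ b) (p q : C(Icc a b, ℝ))
    (hg : Continuous (Function.uncurry (clampField h a b hab p q)))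
    (u : C(Icc a b, ℝ)) (x₀ : ℝ) (t₀ : Icc a b)
    (hu : ∀ t : Icc a b, u t = x₀ + ∫ s in (t₀ : ℝ)..t,
      clampField h a b hab p q s (u (projIcc a b hab s))) (t : ℝ) (ht : t ∈ Icc a b) :
    HasDerivWithinAt (fun s => u (projIcc a b hab s))
      (clampField h a b hab p q t (u (projIcc a b hab t))) (Icc a b) t := by
  have hp : Continuous (projIcc a b hab) := continuous_projIcc
  have key := ODE.hasDerivWithinAt_picard_Icc (f := clampField h a b hab p q)
    (α := fun s => u (projIcc a b hab s)) (u := univ) t₀.2 hg.continuousOn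
    (by fun_prop) (fun _ _ => mem_univ _) x₀ ht
  have e : ∀ r ∈ Icc a b, u (projIcc a b hab r) =
      ODE.picard (clampField h a b hab p q) t₀ x₀ (fun s => u (projIcc a b hab s)) r := by
    intro r hr
    rw [hu, ODE.picard_apply, projIcc_of_mem hab hr]
  exact key.congr e (e t ht)

lemma integral_sol (A : Set (ℝ × ℝ)) (h : ℝ × ℝ → ℝ)
    (a b c d : ℝ) (hab : a ≤ b)
    (hIJ : Icc a b ×ˢ Icc c d ⊆ A) (p q : C(Icc a b, ℝ))
    (hpJ : ∀ t, p t ∈ Icc c d) (hqJ : ∀ t, q t ∈ Icc c d)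
    (hg : Continuous (Function.uncurry (clampField h a b hab p q)))
    (u : C(Icc a b, ℝ)) (hpu : p ≤ u) (huq : u ≤ q) (x₀ : ℝ) (t₀ : Icc a b)
    (hu : ∀ t : Icc a b, u t = x₀ + ∫ s in (t₀ : ℝ)..t,
      clampField h a b hab p q s (u (projIcc a b hab s))) :
    IsODESolOn A h (Icc a b) (fun s => u (projIcc a b hab s)) := by
  constructor
  · intro t ht
    exact hIJ ⟨ht, (hpJ _).1.trans (hpu _), (huq _).trans (hqJ _).2⟩
  · intro t ht
    have key := integral_deriv h a b hab p q hg u x₀ t₀ hu t ht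
    have e : clampField h a b hab p q t (u (projIcc a b hab t))
        = h (t, u (projIcc a b hab t)) := by
      have := clamp_eq h a b hab p q ⟨t, ht⟩ (u ⟨t, ht⟩) (hpu _) (huq _)
      rw [projIcc_of_mem hab ht]
      exact this
    rwa [e] at key

/-- There is a solution through any prescribed point between two given solutions. -/
lemma exists_between_sol (A : Set (ℝ × ℝ)) (h : ℝ × ℝ → ℝ) (hh : ContinuousOn h A)
    (a b c d : ℝ) (hab : a ≤ b)
    (hIJ : Icc a b ×ˢ Icc c d ⊆ A) (p q : C(Icc a b, ℝ))
    (hpJ : ∀ t, p t ∈ Icc c d) (hqJ : ∀ t, q t ∈ Icc c d)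
    (hpq : p ≤ q) (σ ρ : ℝ → ℝ)
    (hσ : IsODESolOn A h (Icc a b) σ) (hpσ : ∀ t : Icc a b, p t = σ t)
    (hρ : IsODESolOn A h (Icc a b) ρ) (hqρ : ∀ t : Icc a b, q t = ρ t)
    (t₀ : Icc a b) (x₀ : ℝ) (h1 : p t₀ ≤ x₀) (h2 : x₀ ≤ q t₀) :
    ∃ w : C(Icc a b, ℝ), p ≤ w ∧ w ≤ q ∧ w t₀ = x₀ ∧
      IsODESolOn A h (Icc a b) (fun s => w (projIcc a b hab s)) := by
  have hg := clamp_cont A h hh a b c d hab hIJ p q hpJ hqJ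
  obtain ⟨M, hM⟩ := clamp_bdd A h hh a b c d hab hIJ p q hpJ hqJ
  obtain ⟨w, hw⟩ := aux_peano a b hab _ hg M hM t₀ x₀
  have hw0 : w t₀ = x₀ := by simpa using hw t₀
  have hd := integral_deriv h a b hab p q hg w x₀ t₀ hw
  have hpw : p ≤ w := by
    have := aux_nonpos a b (fun t => σ t - w (projIcc a b hab t))
      (fun t => h (t, σ t) - clampField h a b hab p q t (w (projIcc a b hab t)))
      (fun t ht => (hσ.2 t ht).sub (hd t ht)) ?_ t₀ t₀.2 ?_
    · intro t
      have := this t t.2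
      simp only [projIcc_val, ← hpσ] at this
      change p t ≤ w t
      linarith
    · intro t ht hpos
      have e := hpσ ⟨t, ht⟩
      have hpq' : p ⟨t, ht⟩ ≤ q ⟨t, ht⟩ := hpq ⟨t, ht⟩
      simp only [projIcc_of_mem hab ht] at hpos
      simp only [clampField, projIcc_of_mem hab ht]
      rw [max_eq_left, e, sub_self]
      refine (min_le_left _ _).trans ?_
      linarith
    · simp only [projIcc_val, ← hpσ, hw0]
      linarith
  have hwq : w ≤ q := by
    have := aux_nonpos a b (fun t => w (projIcc a b hab t) - ρ t)
      (fun t => clampField h a b hab p q t (w (projIcc a b hab t)) - h (t, ρ t))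
      (fun t ht => (hd t ht).sub (hρ.2 t ht)) ?_ t₀ t₀.2 ?_
    · intro t
      have := this t t.2
      simp only [projIcc_val, ← hqρ] at this
      change w t ≤ q t
      linarith
    · intro t ht hpos
      have e := hqρ ⟨t, ht⟩
      have hpq' : p ⟨t, ht⟩ ≤ q ⟨t, ht⟩ := hpq ⟨t, ht⟩
      simp only [projIcc_of_mem hab ht] at hpos
      simp only [clampField, projIcc_of_mem hab ht]
      rw [min_eq_right (by linarith), max_eq_right hpq', e, sub_self]
    · simp only [projIcc_val, ← hqρ, hw0]
      linarith
  exact ⟨w, hpw, hwq, hw0, integral_sol A h a b c d hab hIJ p q hpJ hqJ hg w hpw hwq x₀ t₀ hw⟩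

lemma band_compact (A : Set (ℝ × ℝ)) (h : ℝ × ℝ → ℝ) (hh : ContinuousOn h A)
    (a b c d : ℝ) (hab : a ≤ b)
    (hIJ : Icc a b ×ˢ Icc c d ⊆ A) (p q : C(Icc a b, ℝ))
    (hpJ : ∀ t, p t ∈ Icc c d) (hqJ : ∀ t, q t ∈ Icc c d)
    : IsCompact {u : C(Icc a b, ℝ) | p ≤ u ∧ u ≤ q ∧
    ∃ τ : ℝ → ℝ, IsODESolOn A h (Icc a b) τ ∧ ∀ t : Icc a b, u t = τ t} := by
  have hg := clamp_cont A h hh a b c d hab hIJ p q hpJ hqJ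
  have hp : Continuous (projIcc a b hab) := continuous_projIcc
  obtain ⟨M, hM⟩ := clamp_bdd A h hh a b c d hab hIJ p q hpJ hqJ
  let t₀ : Icc a b := ⟨a, left_mem_Icc.2 hab⟩
  have hset : {u : C(Icc a b, ℝ) | p ≤ u ∧ u ≤ q ∧
      ∃ τ : ℝ → ℝ, IsODESolOn A h (Icc a b) τ ∧ ∀ t : Icc a b, u t = τ t} =
      {u : C(Icc a b, ℝ) | p ≤ u} ∩ ({u | u ≤ q} ∩ {u | ∀ t : Icc a b, u t = u t₀ +
        ∫ s in (t₀ : ℝ)..t, clampField h a b hab p q s (u (projIcc a b hab s))}) := by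
    ext u
    constructor
    · rintro ⟨h1, h2, τ, hτ, hu⟩
      exact ⟨h1, h2, fun t => sol_integral A h a b hab p q hg u h1 h2 τ hτ hu t₀ t⟩
    · rintro ⟨h1, h2, hu⟩
      exact ⟨h1, h2, _, integral_sol A h a b c d hab hIJ p q hpJ hqJ hg u h1 h2 _ t₀ hu,
        fun t => by simp⟩
  rw [hset]
  refine IsCompact.of_isClosed_subset (aux_compact a b M (max |c| |d|)) ?_ ?_
  · refine ((aux_closed_le a b).preimage (f := fun u => (p, u)) (by fun_prop)).inter
      (((aux_closed_le a b).preimage (f := fun u => (u, q)) (by fun_prop)).inter ?_)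
    simp only [ofPred_forall]
    refine isClosed_iInter fun t => isClosed_eq (by fun_prop) ?_
    refine Continuous.add (by fun_prop) ?_
    apply intervalIntegral.continuous_parametric_intervalIntegral_of_continuous'
    exact hg.comp (f := fun z : C(Icc a b, ℝ) × ℝ => (z.2, z.1 (projIcc a b hab z.2)))
      (by fun_prop)
  · rintro u ⟨h1, h2, hu⟩
    have hcont : Continuous fun s => clampField h a b hab p q s (u (projIcc a b hab s)) :=
      hg.comp (f := fun s : ℝ => (s, u (projIcc a b hab s))) (by fun_prop)
    constructor
    · intro t
      exact abs_le_max_abs_abs ((hpJ t).1.trans (h1 t)) ((h2 t).trans (hqJ t).2)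
    · intro s t
      rw [hu s, hu t, add_sub_add_left_eq_sub, intervalIntegral.integral_interval_sub_left
        (hcont.intervalIntegrable _ _) (hcont.intervalIntegrable _ _)]
      exact intervalIntegral.norm_integral_le_of_norm_le_const (a := (t : ℝ)) (b := s)
        (f := fun s => clampField h a b hab p q s (u (projIcc a b hab s))) (C := M)
        (fun s _ => hM _ _)

/-- **Connectedness of the family of intermediate solutions.** Let `A ⊆ ℝ²` be open,
`h : A → ℝ` continuous, `I = [a,b]`, `J = [c,d]` compact intervals with `I × J ⊆ A`, and
let `τ₁ ≤ τ₂` be two solutions of `τ̇ η = h (η, τ η)` on `I` with graphs in `I × J`. Then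
`𝔗(τ₁,τ₂) = { τ : τ solution on I, τ₁ ≤ τ ≤ τ₂ on I }` is a connected subset of `C(I, ℝ)`
with the sup norm (here realized as the space `C([a,b], ℝ)` of continuous maps, whose
topology is that of uniform convergence). -/
theorem solution_family_isConnected
    (A : Set (ℝ × ℝ)) (hA : IsOpen A) (h : ℝ × ℝ → ℝ) (hh : ContinuousOn h A)
    (a b c d : ℝ) (hab : a ≤ b) (hcd : c ≤ d)
    (hIJ : Set.Icc a b ×ˢ Set.Icc c d ⊆ A)
    (τ₁ τ₂ : ℝ → ℝ)
    (h₁ : IsODESolOn A h (Set.Icc a b) τ₁) (h₂ : IsODESolOn A h (Set.Icc a b) τ₂)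
    (h₁J : Set.MapsTo τ₁ (Set.Icc a b) (Set.Icc c d))
    (h₂J : Set.MapsTo τ₂ (Set.Icc a b) (Set.Icc c d))
    (hle : ∀ η ∈ Set.Icc a b, τ₁ η ≤ τ₂ η) :
    IsConnected {u : C(Set.Icc a b, ℝ) | ∃ τ : ℝ → ℝ,
      IsODESolOn A h (Set.Icc a b) τ ∧
      (∀ η ∈ Set.Icc a b, τ₁ η ≤ τ η ∧ τ η ≤ τ₂ η) ∧
      ∀ η : Set.Icc a b, u η = τ (η : ℝ)} := by
  have hc₁ : ContinuousOn τ₁ (Icc a b) := fun t ht => (h₁.2 t ht).continuousWithinAt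
  have hc₂ : ContinuousOn τ₂ (Icc a b) := fun t ht => (h₂.2 t ht).continuousWithinAt
  let p : C(Icc a b, ℝ) := ⟨fun t => τ₁ t, hc₁.domRestrict⟩
  let q : C(Icc a b, ℝ) := ⟨fun t => τ₂ t, hc₂.domRestrict⟩
  have hpJ : ∀ t, p t ∈ Icc c d := fun t => h₁J t.2
  have hqJ : ∀ t, q t ∈ Icc c d := fun t => h₂J t.2
  have hpq : p ≤ q := fun t => hle t t.2
  have hset : {u : C(Set.Icc a b, ℝ) | ∃ τ : ℝ → ℝ,
      IsODESolOn A h (Set.Icc a b) τ ∧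
      (∀ η ∈ Set.Icc a b, τ₁ η ≤ τ η ∧ τ η ≤ τ₂ η) ∧
      ∀ η : Set.Icc a b, u η = τ (η : ℝ)} = {u : C(Icc a b, ℝ) | p ≤ u ∧ u ≤ q ∧
      ∃ τ : ℝ → ℝ, IsODESolOn A h (Icc a b) τ ∧ ∀ t : Icc a b, u t = τ t} := by
    ext u
    constructor
    · rintro ⟨τ, hτ, hb, hu⟩
      refine ⟨fun t => ?_, fun t => ?_, τ, hτ, hu⟩
      · change τ₁ t ≤ u t
        rw [hu t]
        exact (hb t t.2).1
      · change u t ≤ τ₂ t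
        rw [hu t]
        exact (hb t t.2).2
    · rintro ⟨hb1, hb2, τ, hτ, hu⟩
      refine ⟨τ, hτ, fun η hη => ?_, hu⟩
      have e := hu ⟨η, hη⟩
      have e1 : τ₁ η ≤ u ⟨η, hη⟩ := hb1 ⟨η, hη⟩
      have e2 : u ⟨η, hη⟩ ≤ τ₂ η := hb2 ⟨η, hη⟩
      rw [e] at e1 e2
      exact ⟨e1, e2⟩
  rw [hset]
  have hq : q ∈ {u : C(Icc a b, ℝ) | p ≤ u ∧ u ≤ q ∧
      ∃ τ : ℝ → ℝ, IsODESolOn A h (Icc a b) τ ∧ ∀ t : Icc a b, u t = τ t} :=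
    ⟨hpq, le_rfl, τ₂, h₂, fun _ => rfl⟩
  refine ⟨⟨q, hq⟩, aux_connected a b hab _
    (band_compact A h hh a b c d hab hIJ p q hpJ hqJ) ?_ q hq (fun u hu => hu.2.1)⟩
  rintro u ⟨hpu, huq, σ, hσ, huσ⟩ v ⟨hpv, hvq, ρ, hρ, hvρ⟩ huv hne
  obtain ⟨t, ht⟩ : ∃ t, u t ≠ v t := by
    by_contra! hcon
    exact hne (ContinuousMap.ext hcon)
  have hlt : u t < v t := lt_of_le_of_ne (huv t) ht
  obtain ⟨w, hw1, hw2, hw3, hw4⟩ := exists_between_sol A h hh a b c d hab hIJ u v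
    (fun t => ⟨(hpJ t).1.trans (hpu t), (huq t).trans (hqJ t).2⟩)
    (fun t => ⟨(hpJ t).1.trans (hpv t), (hvq t).trans (hqJ t).2⟩) huv σ ρ hσ huσ hρ hvρ t
    ((u t + v t) / 2) (by linarith) (by linarith)
  refine ⟨w, ⟨hpu.trans hw1, hw2.trans hvq, _, hw4, fun t => by simp⟩, hw1, hw2, ?_, ?_⟩
  · rintro rfl
    linarith
  · rintro rfl
    linarith
end
end

section
/- Let A ⊂ ℝ² be open, let h: A → ℝ be continuous, let I and J be compact intervals with I×J ⊂ A, and let τ₁, τ₂ be two solutions of the ODE τ̇(η) = h(η,τ(η)) on I with graphs contained in I×J and τ₁ ≤ τ₂ on I. Then { ∫_I τ(η) dη : τ ∈ 𝔗(τ₁,τ₂) } = [ ∫_I τ₁(η) dη, ∫_I τ₂(η) dη ], where 𝔗(τ₁,τ₂) = { τ : τ is a solution of the ODE on I with τ₁ ≤ τ ≤ τ₂ on I }. -/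
noncomputable section

open Set

open Filter Topology MeasureTheory
open scoped NNReal

lemma aux_compact_s9 (a b : ℝ) (hab : a ≤ b) (M : ℝ≥0) (R : ℝ) (y : ℕ → ℝ → ℝ)
    (hL : ∀ n, LipschitzOnWith M (y n) (Set.Icc a b))
    (hR : ∀ n, ∀ t ∈ Set.Icc a b, |y n t| ≤ R) :
    ∃ (z : ℝ → ℝ) (φ : ℕ → ℕ), StrictMono φ ∧ ContinuousOn z (Set.Icc a b) ∧
      ∀ t ∈ Set.Icc a b, Tendsto (fun n => y (φ n) t) atTop (𝓝 (z t)) := by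
  let f : ℕ → BoundedContinuousFunction (Set.Icc a b) ℝ := fun n =>
    BoundedContinuousFunction.mkOfCompact ⟨(Set.Icc a b).domRestrict (y n),
      (hL n).continuousOn.domRestrict⟩
  have hf : ∀ n (t : Set.Icc a b), f n t = y n t := fun n t => rfl
  have hc : IsCompact (closure (Set.range f)) := by
    refine BoundedContinuousFunction.arzela_ascoli (Set.Icc (-R) R) isCompact_Icc _ ?_ ?_
    · rintro _ x ⟨n, rfl⟩
      exact abs_le.mp (hR n x x.2)
    · refine (LipschitzWith.uniformEquicontinuous _ M ?_).equicontinuous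
      rintro ⟨_, n, rfl⟩
      exact lipschitzOnWith_iff_restrict.mp (hL n)
  obtain ⟨g, -, φ, hφ, hg⟩ := hc.tendsto_subseq (x := f)
    (fun n => subset_closure (Set.mem_range_self n))
  refine ⟨fun t => g (Set.projIcc a b hab t), φ, hφ,
    (g.continuous.comp continuous_projIcc).continuousOn, fun t ht => ?_⟩
  have h1 : Tendsto (fun n => f (φ n) ⟨t, ht⟩) atTop (𝓝 (g ⟨t, ht⟩)) :=
    ((continuous_eval_const (⟨t, ht⟩ : Set.Icc a b)).tendsto g).comp hg
  simp only [Set.projIcc_of_mem hab ht]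
  exact h1

lemma aux_int_deriv (a b : ℝ) (hab : a ≤ b) (t0 : ℝ) (ht0 : t0 ∈ Set.Icc a b)
    (y g : ℝ → ℝ) (hg : ContinuousOn g (Set.Icc a b))
    (hy : ∀ t ∈ Set.Icc a b, y t = y t0 + ∫ s in t0..t, g s) :
    ∀ t ∈ Set.Icc a b, HasDerivWithinAt y (g t) (Set.Icc a b) t := by
  intro t ht
  let G : ℝ → ℝ := fun s => g (Set.projIcc a b hab s)
  have hGc : Continuous G :=
    hg.comp_continuous (continuous_subtype_val.comp continuous_projIcc) (fun s => (Set.projIcc a b hab s).2)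
  have hGe : ∀ s ∈ Set.Icc a b, G s = g s := fun s hs => by
    simp only [G, Set.projIcc_of_mem hab hs]
  have h1 : HasDerivAt (fun u => y t0 + ∫ s in t0..u, G s) (G t) t :=
    (intervalIntegral.integral_hasDerivAt_right (hGc.intervalIntegrable _ _)
      (hGc.stronglyMeasurableAtFilter _ _) hGc.continuousAt).const_add _
  rw [hGe t ht] at h1
  have key : ∀ u ∈ Set.Icc a b, y u = y t0 + ∫ s in t0..u, G s := by
    intro u hu
    rw [hy u hu]
    congr 1
    refine intervalIntegral.integral_congr fun s hs => (hGe s ?_).symm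
    exact Set.uIcc_subset_Icc ht0 hu hs
  exact h1.hasDerivWithinAt.congr key (key t ht)

lemma aux_deriv_int (a b : ℝ) (t0 : ℝ) (ht0 : t0 ∈ Set.Icc a b)
    (y g : ℝ → ℝ) (hg : ContinuousOn g (Set.Icc a b))
    (hy : ∀ t ∈ Set.Icc a b, HasDerivWithinAt y (g t) (Set.Icc a b) t) :
    ∀ t ∈ Set.Icc a b, y t = y t0 + ∫ s in t0..t, g s := by
  intro t ht
  have hsub := Set.uIcc_subset_Icc ht0 ht
  rw [intervalIntegral.integral_eq_sub_of_hasDeriv_right (f := y)]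
  · ring
  · exact fun s hs => (hy s (hsub hs)).continuousWithinAt.mono hsub
  · intro s hs
    have h1 : s ∈ Set.Icc a b := hsub ⟨hs.1.le, hs.2.le⟩
    have h2 : s < b := lt_of_lt_of_le hs.2 (max_le ht0.2 ht.2)
    exact (hy s h1).mono_of_mem_nhdsWithin
      (mem_of_superset (Ioc_mem_nhdsGT h2) fun u hu => ⟨h1.1.trans hu.1.le, hu.2⟩)
  · exact (hg.mono hsub).intervalIntegrable

lemma aux_limit (a b : ℝ) (hab : a ≤ b) (t0 : ℝ) (ht0 : t0 ∈ Set.Icc a b) (M : ℝ)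
    (y g : ℕ → ℝ → ℝ) (z k : ℝ → ℝ)
    (hg : ∀ n, ContinuousOn (g n) (Set.Icc a b))
    (hgM : ∀ n, ∀ t ∈ Set.Icc a b, |g n t| ≤ M)
    (hy : ∀ n, ∀ t ∈ Set.Icc a b, y n t = y n t0 + ∫ s in t0..t, g n s)
    (hk : ContinuousOn k (Set.Icc a b))
    (hyz : ∀ t ∈ Set.Icc a b, Tendsto (fun n => y n t) atTop (𝓝 (z t)))
    (hgk : ∀ t ∈ Set.Icc a b, Tendsto (fun n => g n t) atTop (𝓝 (k t))) :
    ∀ t ∈ Set.Icc a b, HasDerivWithinAt z (k t) (Set.Icc a b) t := by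
  refine aux_int_deriv a b hab t0 ht0 z k hk fun t ht => ?_
  have hsub := Set.uIcc_subset_Icc ht0 ht
  have hsub' := Set.uIoc_subset_uIcc.trans hsub
  have h1 : Tendsto (fun n => ∫ s in t0..t, g n s) atTop (𝓝 (∫ s in t0..t, k s)) := by
    refine intervalIntegral.tendsto_integral_filter_of_dominated_convergence (fun _ => M) ?_ ?_ ?_ ?_
    · exact Eventually.of_forall fun n =>
        ((hg n).mono hsub').aestronglyMeasurable measurableSet_uIoc
    · exact Eventually.of_forall fun n => Eventually.of_forall fun s hs => hgM n s (hsub' hs)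
    · exact intervalIntegrable_const
    · exact Eventually.of_forall fun s hs => hgk s (hsub' hs)
  have h2 := (hyz t0 ht0).add h1
  refine tendsto_nhds_unique (hyz t ht) (h2.congr fun n => (hy n t ht).symm)

lemma aux_lip_s9 (a b : ℝ) (M : ℝ≥0) (y g : ℝ → ℝ)
    (hgM : ∀ t ∈ Set.Icc a b, |g t| ≤ M)
    (hy : ∀ t ∈ Set.Icc a b, HasDerivWithinAt y (g t) (Set.Icc a b) t) :
    LipschitzOnWith M y (Set.Icc a b) :=
  (convex_Icc a b).lipschitzOnWith_of_nnnorm_hasDerivWithin_le hy fun t ht => by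
    rw [← NNReal.coe_le_coe]; exact hgM t ht

/-- Shift `s` toward `t0` by at most `δ`. -/
noncomputable def auxShift (t0 δ s : ℝ) : ℝ := s - max (-δ) (min (s - t0) δ)

lemma auxShift_cont (t0 δ : ℝ) : Continuous (auxShift t0 δ) := by
  unfold auxShift; fun_prop

lemma auxShift_dist (t0 δ s : ℝ) (hδ : 0 ≤ δ) : |auxShift t0 δ s - s| ≤ δ := by
  unfold auxShift
  rw [abs_le]
  constructor
  · have : max (-δ) (min (s - t0) δ) ≤ δ := max_le (by linarith) (min_le_right _ _)
    linarith
  · have : -δ ≤ max (-δ) (min (s - t0) δ) := le_max_left _ _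
    linarith

lemma auxShift_near (t0 δ s r : ℝ) (hr : 0 ≤ r) (hδ : 0 ≤ δ) (hs : |s - t0| ≤ r + δ) :
    |auxShift t0 δ s - t0| ≤ r := by
  unfold auxShift
  rw [abs_le] at *
  rcases max_cases (-δ) (min (s - t0) δ) with h | h <;>
  rcases min_cases (s - t0) δ with h' | h' <;> constructor <;> linarith

lemma auxShift_mem (t0 δ s a b : ℝ) (hδ : 0 ≤ δ) (ht0 : t0 ∈ Set.Icc a b) (hs : s ∈ Set.Icc a b) :
    auxShift t0 δ s ∈ Set.Icc a b := by
  obtain ⟨h1, h2⟩ := ht0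
  obtain ⟨h3, h4⟩ := hs
  unfold auxShift
  rcases max_cases (-δ) (min (s - t0) δ) with h | h <;>
  rcases min_cases (s - t0) δ with h' | h' <;> constructor <;> linarith

/-- Iterates for the delayed equation. -/
noncomputable def auxIter (G : ℝ × ℝ → ℝ) (t0 x0 δ : ℝ) : ℕ → ℝ → ℝ
  | 0 => fun _ => x0
  | n + 1 => fun t => x0 + ∫ s in t0..t, G (s, auxIter G t0 x0 δ n (auxShift t0 δ s))

lemma auxIter_cont (G : ℝ × ℝ → ℝ) (hG : Continuous G) (t0 x0 δ : ℝ) (n : ℕ) :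
    Continuous (auxIter G t0 x0 δ n) := by
  induction n with
  | zero => exact continuous_const
  | succ n ih =>
    have h1 : Continuous fun s => G (s, auxIter G t0 x0 δ n (auxShift t0 δ s)) :=
      hG.comp (continuous_id.prodMk (ih.comp (auxShift_cont t0 δ)))
    exact continuous_const.add
      (intervalIntegral.continuous_primitive (fun u v => h1.intervalIntegrable u v) t0)

lemma auxIter_eq (G : ℝ × ℝ → ℝ) (t0 x0 δ : ℝ) (hδ : 0 ≤ δ) (n : ℕ) :
    ∀ t, |t - t0| ≤ n * δ → auxIter G t0 x0 δ (n + 1) t = auxIter G t0 x0 δ n t := by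
  induction n with
  | zero =>
    intro t ht
    have : t = t0 := by
      simp only [Nat.cast_zero, zero_mul] at ht
      linarith [abs_nonpos_iff.mp ht]
    subst this
    simp [auxIter]
  | succ n ih =>
    intro t ht
    change x0 + (∫ s in t0..t, G (s, auxIter G t0 x0 δ (n + 1) (auxShift t0 δ s))) =
      x0 + ∫ s in t0..t, G (s, auxIter G t0 x0 δ n (auxShift t0 δ s))
    congr 1
    refine intervalIntegral.integral_congr fun s hs => ?_
    have h1 : |s - t0| ≤ |t - t0| := Set.abs_sub_left_of_mem_uIcc hs
    have h2 : |auxShift t0 δ s - t0| ≤ n * δ := by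
      refine auxShift_near t0 δ s _ (by positivity) hδ ?_
      push_cast at ht
      linarith
    simp only [ih _ h2]

lemma aux_peano_s9 (G : ℝ × ℝ → ℝ) (hG : Continuous G) (M : ℝ≥0) (hM : ∀ p, |G p| ≤ M)
    (a b : ℝ) (hab : a ≤ b) (t0 : ℝ) (ht0 : t0 ∈ Set.Icc a b) (x0 : ℝ) :
    ∃ y : ℝ → ℝ, y t0 = x0 ∧
      ∀ t ∈ Set.Icc a b, HasDerivWithinAt y (G (t, y t)) (Set.Icc a b) t := by
  let δ : ℕ → ℝ := fun n => (b - a) / (n + 1)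
  have hδ : ∀ n, 0 ≤ δ n := fun n => div_nonneg (by linarith) (by positivity)
  have hδ0 : Tendsto δ atTop (𝓝 0) := by
    have := (tendsto_one_div_add_atTop_nhds_zero_nat (𝕜 := ℝ)).const_mul (b - a)
    simpa [δ, div_eq_mul_inv] using this
  let y : ℕ → ℝ → ℝ := fun n => auxIter G t0 x0 (δ n) (n + 1)
  let g : ℕ → ℝ → ℝ := fun n s => G (s, y n (auxShift t0 (δ n) s))
  have hyc : ∀ n, Continuous (y n) := fun n => auxIter_cont G hG _ _ _ _
  have hgc : ∀ n, Continuous (g n) := fun n =>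
    hG.comp (continuous_id.prodMk ((hyc n).comp (auxShift_cont t0 (δ n))))
  have hyx : ∀ n, ∀ t ∈ Set.Icc a b, y n t = x0 + ∫ s in t0..t, g n s := by
    intro n t ht
    have h1 := auxIter_eq G t0 x0 (δ n) (hδ n) (n + 1) t (by
      have : ((n + 1 : ℕ) : ℝ) * δ n = b - a := by
        simp only [δ]; push_cast; field_simp
      rw [this, abs_le]
      constructor <;> linarith [ht.1, ht.2, ht0.1, ht0.2])
    exact h1.symm
  have hy0 : ∀ n, y n t0 = x0 := fun n => by rw [hyx n t0 ht0]; simp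
  have hy1 : ∀ n, ∀ t ∈ Set.Icc a b, y n t = y n t0 + ∫ s in t0..t, g n s := by
    intro n t ht; rw [hy0 n]; exact hyx n t ht
  have hL : ∀ n, LipschitzOnWith M (y n) (Set.Icc a b) := fun n =>
    aux_lip_s9 a b M _ (g n) (fun t _ => hM _)
      (aux_int_deriv a b hab t0 ht0 _ _ (hgc n).continuousOn (hy1 n))
  have hLd : ∀ n, ∀ s ∈ Set.Icc a b, ∀ t ∈ Set.Icc a b, |y n s - y n t| ≤ M * |s - t| := by
    intro n s hs t ht
    have := (hL n).dist_le_mul s hs t ht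
    simpa [Real.dist_eq] using this
  obtain ⟨z, φ, hφ, hz, hlim⟩ := aux_compact_s9 a b hab M (|x0| + M * (b - a)) y hL (by
    intro n t ht
    have h1 := hLd n t ht t0 ht0
    rw [hy0] at h1
    have h2 : |t - t0| ≤ b - a := by
      rw [abs_le]; constructor <;> linarith [ht.1, ht.2, ht0.1, ht0.2]
    have h3 := mul_le_mul_of_nonneg_left h2 M.coe_nonneg
    have h4 := abs_sub_abs_le_abs_sub (y n t) x0
    linarith)
  refine ⟨z, tendsto_nhds_unique (hlim t0 ht0) (by simp [hy0]), ?_⟩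
  refine aux_limit a b hab t0 ht0 M (fun n => y (φ n)) (fun n => g (φ n)) z (fun t => G (t, z t))
    (fun n => (hgc _).continuousOn) (fun n t _ => hM _) (fun n => hy1 _)
    (hG.comp_continuousOn (continuousOn_id.prodMk hz)) hlim ?_
  intro t ht
  have h1 : Tendsto (fun n => y (φ n) (auxShift t0 (δ (φ n)) t) - y (φ n) t) atTop (𝓝 0) := by
    refine squeeze_zero_norm (a := fun n => M * δ (φ n)) (fun n => ?_) ?_
    · refine (hLd _ _ (auxShift_mem _ _ _ _ _ (hδ _) ht0 ht) _ ht).trans ?_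
      exact mul_le_mul_of_nonneg_left (auxShift_dist _ _ _ (hδ _)) M.coe_nonneg
    · simpa using (hδ0.comp hφ.tendsto_atTop).const_mul (M : ℝ)
  have h2 : Tendsto (fun n => y (φ n) (auxShift t0 (δ (φ n)) t)) atTop (𝓝 (z t)) := by
    simpa using h1.add (hlim t ht)
  exact (hG.tendsto (t, z t)).comp (tendsto_const_nhds.prodMk_nhds h2)

lemma aux_max_sq (x : ℝ) : HasDerivAt (fun x : ℝ => (max x 0) ^ 2) (2 * max x 0) x := by
  rcases lt_trichotomy x 0 with hx | hx | hx
  · rw [max_eq_right hx.le, mul_zero]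
    refine (hasDerivAt_const x (0 : ℝ)).congr_of_eventuallyEq ?_
    filter_upwards [eventually_lt_nhds hx] with u hu
    simp [max_eq_right hu.le]
  · subst hx
    rw [max_self, mul_zero, hasDerivAt_iff_isLittleO]
    have h1 : (fun x : ℝ => x ^ 2) =o[𝓝 0] fun x => x :=
      Asymptotics.isLittleO_pow_id (by norm_num)
    have h2 : (fun x : ℝ => (max x 0) ^ 2) =o[𝓝 0] fun x => x := by
      refine Asymptotics.IsBigO.trans_isLittleO (Asymptotics.IsBigO.of_bound 1 ?_) h1
      refine Eventually.of_forall fun u => ?_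
      rw [one_mul, Real.norm_eq_abs, Real.norm_eq_abs, abs_of_nonneg (sq_nonneg _),
        abs_of_nonneg (sq_nonneg _)]
      rcases max_cases u 0 with h | h <;> rw [h.1]
      nlinarith [sq_nonneg u]
    simpa using h2
  · rw [max_eq_left hx.le]
    have h1 : HasDerivAt (fun u : ℝ => u ^ 2) (2 * x) x := by simpa using hasDerivAt_pow 2 x
    refine h1.congr_of_eventuallyEq ?_
    filter_upwards [eventually_gt_nhds hx] with u hu
    simp [max_eq_left hu.le]

lemma aux_barrier (a b : ℝ) (t0 : ℝ) (ht0 : t0 ∈ Set.Icc a b) (y σ y' σ' : ℝ → ℝ)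
    (hy : ∀ t ∈ Set.Icc a b, HasDerivWithinAt y (y' t) (Set.Icc a b) t)
    (hσ : ∀ t ∈ Set.Icc a b, HasDerivWithinAt σ (σ' t) (Set.Icc a b) t)
    (he : ∀ t ∈ Set.Icc a b, σ t ≤ y t → y' t = σ' t)
    (h0 : y t0 ≤ σ t0) : ∀ t ∈ Set.Icc a b, y t ≤ σ t := by
  intro t ht
  have hd : ∀ s ∈ Set.Icc a b,
      HasDerivWithinAt (fun s => (max (y s - σ s) 0) ^ 2) ((fun _ => 0 : ℝ → ℝ) s)
        (Set.Icc a b) s := by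
    intro s hs
    have h1 := (aux_max_sq (y s - σ s)).comp_hasDerivWithinAt s ((hy s hs).sub (hσ s hs))
    have h2 : 2 * max (y s - σ s) 0 * (y' s - σ' s) = 0 := by
      rcases le_total (σ s) (y s) with h | h
      · rw [he s hs h]; ring
      · rw [max_eq_right (by linarith)]; ring
    rw [h2] at h1
    exact h1
  have hL := aux_lip_s9 a b 0 _ _ (fun t _ => by simp) hd
  have h3 := hL.dist_le_mul t ht t0 ht0
  rw [NNReal.coe_zero, zero_mul, max_eq_right (a := y t0 - σ t0) (by linarith)] at h3
  have h4 := dist_le_zero.mp h3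
  have h5 : max (y t - σ t) 0 = 0 := by simpa using h4
  linarith [le_max_left (y t - σ t) 0]

lemma IsODESolOn.contOn {A : Set (ℝ × ℝ)} {h : ℝ × ℝ → ℝ} {S : Set ℝ} {τ : ℝ → ℝ}
    (H : IsODESolOn A h S τ) : ContinuousOn τ S := fun t ht => (H.2 t ht).continuousWithinAt

lemma aux_clamp (A : Set (ℝ × ℝ)) (h : ℝ × ℝ → ℝ) (hh : ContinuousOn h A)
    (a b c d : ℝ) (hab : a ≤ b) (hIJ : Set.Icc a b ×ˢ Set.Icc c d ⊆ A)
    (σ σ' : ℝ → ℝ) (hσ : ContinuousOn σ (Set.Icc a b)) (hσ' : ContinuousOn σ' (Set.Icc a b))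
    (hJ : Set.MapsTo σ (Set.Icc a b) (Set.Icc c d))
    (hJ' : Set.MapsTo σ' (Set.Icc a b) (Set.Icc c d)) :
    ∃ (G : ℝ × ℝ → ℝ) (M : ℝ≥0), Continuous G ∧ (∀ p, |G p| ≤ M) ∧
      ∀ t ∈ Set.Icc a b, ∀ x, G (t, x) = h (t, max (σ t) (min x (σ' t))) := by
  let P : ℝ → ℝ := fun s => Set.projIcc a b hab s
  have hPc : Continuous P := continuous_subtype_val.comp continuous_projIcc
  have hPm : ∀ s, P s ∈ Set.Icc a b := fun s => (Set.projIcc a b hab s).2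
  have hPe : ∀ s ∈ Set.Icc a b, P s = s := fun s hs => by simp only [P, Set.projIcc_of_mem hab hs]
  let Q : ℝ × ℝ → ℝ × ℝ := fun p => (P p.1, max (σ (P p.1)) (min p.2 (σ' (P p.1))))
  have h1 : Continuous fun s => σ (P s) := hσ.comp_continuous hPc hPm
  have h2 : Continuous fun s => σ' (P s) := hσ'.comp_continuous hPc hPm
  have hQc : Continuous Q :=
    (hPc.comp continuous_fst).prodMk ((h1.comp continuous_fst).max
      (continuous_snd.min (h2.comp continuous_fst)))
  have hQm : ∀ p, Q p ∈ Set.Icc a b ×ˢ Set.Icc c d := fun p =>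
    ⟨hPm _, (hJ (hPm p.1)).1.trans (le_max_left _ _),
      max_le (hJ (hPm p.1)).2 ((min_le_right _ _).trans (hJ' (hPm p.1)).2)⟩
  obtain ⟨C, hC⟩ := (isCompact_Icc.prod isCompact_Icc).exists_bound_of_continuousOn (hh.mono hIJ)
  refine ⟨fun p => h (Q p), C.toNNReal, hh.comp_continuous hQc fun p => hIJ (hQm p), fun p => ?_, ?_⟩
  · exact (hC _ (hQm p)).trans (Real.le_coe_toNNReal C)
  · intro t ht x
    simp only [Q, hPe t ht]

lemma aux_between (A : Set (ℝ × ℝ)) (h : ℝ × ℝ → ℝ) (hh : ContinuousOn h A)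
    (a b c d : ℝ) (hab : a ≤ b) (hIJ : Set.Icc a b ×ˢ Set.Icc c d ⊆ A)
    (σ σ' : ℝ → ℝ) (hσ : IsODESolOn A h (Set.Icc a b) σ) (hσ' : IsODESolOn A h (Set.Icc a b) σ')
    (hJ : Set.MapsTo σ (Set.Icc a b) (Set.Icc c d))
    (hJ' : Set.MapsTo σ' (Set.Icc a b) (Set.Icc c d))
    (hle : ∀ t ∈ Set.Icc a b, σ t ≤ σ' t)
    (t0 : ℝ) (ht0 : t0 ∈ Set.Icc a b) (x0 : ℝ) (hx : σ t0 ≤ x0) (hx' : x0 ≤ σ' t0) :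
    ∃ y, IsODESolOn A h (Set.Icc a b) y ∧ (∀ t ∈ Set.Icc a b, σ t ≤ y t ∧ y t ≤ σ' t) ∧
      y t0 = x0 := by
  obtain ⟨G, M, hG, hM, hGe⟩ :=
    aux_clamp A h hh a b c d hab hIJ σ σ' hσ.contOn hσ'.contOn hJ hJ'
  obtain ⟨y, hy0, hy⟩ := aux_peano_s9 G hG M hM a b hab t0 ht0 x0
  have hup : ∀ t ∈ Set.Icc a b, y t ≤ σ' t := by
    refine aux_barrier a b t0 ht0 y σ' _ _ hy hσ'.2 ?_ (hy0.trans_le hx')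
    intro t ht hty
    rw [hGe t ht, min_eq_right hty, max_eq_right (hle t ht)]
  have hlo : ∀ t ∈ Set.Icc a b, σ t ≤ y t := by
    refine aux_barrier a b t0 ht0 σ y _ _ hσ.2 hy ?_ (hx.trans_eq hy0.symm)
    intro t ht hty
    rw [hGe t ht, min_eq_left (hty.trans (hle t ht)), max_eq_left hty]
  refine ⟨y, ⟨fun t ht => hIJ ⟨ht, (hJ ht).1.trans (hlo t ht), (hup t ht).trans (hJ' ht).2⟩,
    fun t ht => ?_⟩, fun t ht => ⟨hlo t ht, hup t ht⟩, hy0⟩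
  have := hy t ht
  rwa [hGe t ht, min_eq_left (hup t ht), max_eq_right (hlo t ht)] at this

lemma aux_seq (A : Set (ℝ × ℝ)) (h : ℝ × ℝ → ℝ) (hh : ContinuousOn h A)
    (a b c d : ℝ) (hab : a ≤ b) (hIJ : Set.Icc a b ×ˢ Set.Icc c d ⊆ A)
    (σ σ' : ℝ → ℝ) (hσ : IsODESolOn A h (Set.Icc a b) σ) (hσ' : IsODESolOn A h (Set.Icc a b) σ')
    (hJ : Set.MapsTo σ (Set.Icc a b) (Set.Icc c d))
    (hJ' : Set.MapsTo σ' (Set.Icc a b) (Set.Icc c d))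
    (y : ℕ → ℝ → ℝ) (hy : ∀ n, IsODESolOn A h (Set.Icc a b) (y n))
    (hb : ∀ n, ∀ t ∈ Set.Icc a b, σ t ≤ y n t ∧ y n t ≤ σ' t) :
    ∃ (z : ℝ → ℝ) (φ : ℕ → ℕ), StrictMono φ ∧ IsODESolOn A h (Set.Icc a b) z ∧
      (∀ t ∈ Set.Icc a b, σ t ≤ z t ∧ z t ≤ σ' t) ∧
      (∀ t ∈ Set.Icc a b, Tendsto (fun n => y (φ n) t) atTop (𝓝 (z t))) ∧
      Tendsto (fun n => ∫ t in a..b, y (φ n) t) atTop (𝓝 (∫ t in a..b, z t)) := by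
  obtain ⟨G, M, hG, hM, hGe⟩ :=
    aux_clamp A h hh a b c d hab hIJ σ σ' hσ.contOn hσ'.contOn hJ hJ'
  have hGe' : ∀ t ∈ Set.Icc a b, ∀ x, σ t ≤ x → x ≤ σ' t → G (t, x) = h (t, x) := by
    intro t ht x h1 h2
    rw [hGe t ht, min_eq_left h2, max_eq_right h1]
  have hyd : ∀ n, ∀ t ∈ Set.Icc a b,
      HasDerivWithinAt (y n) (G (t, y n t)) (Set.Icc a b) t := by
    intro n t ht
    rw [hGe' t ht _ (hb n t ht).1 (hb n t ht).2]
    exact (hy n).2 t ht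
  have hL : ∀ n, LipschitzOnWith M (y n) (Set.Icc a b) := fun n =>
    aux_lip_s9 a b M _ _ (fun t _ => hM _) (hyd n)
  have hR : ∀ n, ∀ t ∈ Set.Icc a b, |y n t| ≤ max |c| |d| := fun n t ht =>
    abs_le_max_abs_abs ((hJ ht).1.trans (hb n t ht).1) ((hb n t ht).2.trans (hJ' ht).2)
  obtain ⟨z, φ, hφ, hz, hlim⟩ := aux_compact_s9 a b hab M _ y hL hR
  have hzb : ∀ t ∈ Set.Icc a b, σ t ≤ z t ∧ z t ≤ σ' t := fun t ht =>
    ⟨ge_of_tendsto' (hlim t ht) fun n => (hb _ t ht).1,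
      le_of_tendsto' (hlim t ht) fun n => (hb _ t ht).2⟩
  have ha : a ∈ Set.Icc a b := ⟨le_rfl, hab⟩
  have hgc : ∀ u : ℝ → ℝ, ContinuousOn u (Set.Icc a b) →
      ContinuousOn (fun t => G (t, u t)) (Set.Icc a b) := fun u hu =>
    hG.comp_continuousOn (continuousOn_id.prodMk hu)
  have hzd := aux_limit a b hab a ha M (fun n => y (φ n)) (fun n t => G (t, y (φ n) t)) z
    (fun t => G (t, z t)) (fun n => hgc _ (hL _).continuousOn) (fun n t _ => hM _)
    (fun n => aux_deriv_int a b a ha _ _ (hgc _ (hL _).continuousOn) (hyd _)) (hgc z hz) hlim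
    (fun t ht => (hG.tendsto (t, z t)).comp (tendsto_const_nhds.prodMk_nhds (hlim t ht)))
  refine ⟨z, φ, hφ, ⟨fun t ht => hIJ ⟨ht, (hJ ht).1.trans (hzb t ht).1,
    (hzb t ht).2.trans (hJ' ht).2⟩, fun t ht => ?_⟩, hzb, hlim, ?_⟩
  · rw [← hGe' t ht _ (hzb t ht).1 (hzb t ht).2]
    exact hzd t ht
  · have hsub' : Set.uIoc a b ⊆ Set.Icc a b := by
      rw [Set.uIoc_of_le hab]; exact Set.Ioc_subset_Icc_self
    refine intervalIntegral.tendsto_integral_filter_of_dominated_convergence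
      (fun _ => max |c| |d|) ?_ ?_ ?_ ?_
    · exact Eventually.of_forall fun n =>
        ((hL _).continuousOn.mono hsub').aestronglyMeasurable measurableSet_uIoc
    · exact Eventually.of_forall fun n => Eventually.of_forall fun s hs => hR _ s (hsub' hs)
    · exact intervalIntegrable_const
    · exact Eventually.of_forall fun s hs => hlim s (hsub' hs)

/-- **The integrals of intermediate solutions fill an interval.** Let `A ⊆ ℝ²` be open,
`h : A → ℝ` continuous, `I = [a,b]`, `J = [c,d]` compact intervals with `I × J ⊆ A`, and
let `τ₁ ≤ τ₂` be two solutions of `τ̇ η = h (η, τ η)` on `I` with graphs in `I × J`. Then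
`{ ∫_I τ : τ ∈ 𝔗(τ₁,τ₂) } = [∫_I τ₁, ∫_I τ₂]`, where
`𝔗(τ₁,τ₂) = { τ : τ solution on I, τ₁ ≤ τ ≤ τ₂ on I }`. -/
theorem integrals_of_solution_family_eq_Icc
    (A : Set (ℝ × ℝ)) (hA : IsOpen A) (h : ℝ × ℝ → ℝ) (hh : ContinuousOn h A)
    (a b c d : ℝ) (hab : a ≤ b) (hcd : c ≤ d)
    (hIJ : Set.Icc a b ×ˢ Set.Icc c d ⊆ A)
    (τ₁ τ₂ : ℝ → ℝ)
    (h₁ : IsODESolOn A h (Set.Icc a b) τ₁) (h₂ : IsODESolOn A h (Set.Icc a b) τ₂)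
    (h₁J : Set.MapsTo τ₁ (Set.Icc a b) (Set.Icc c d))
    (h₂J : Set.MapsTo τ₂ (Set.Icc a b) (Set.Icc c d))
    (hle : ∀ η ∈ Set.Icc a b, τ₁ η ≤ τ₂ η) :
    {μ : ℝ | ∃ τ : ℝ → ℝ, IsODESolOn A h (Set.Icc a b) τ ∧
        (∀ η ∈ Set.Icc a b, τ₁ η ≤ τ η ∧ τ η ≤ τ₂ η) ∧
        μ = ∫ η in a..b, τ η} =
      Set.Icc (∫ η in a..b, τ₁ η) (∫ η in a..b, τ₂ η) := by
  have hmono : ∀ u v : ℝ → ℝ, IsODESolOn A h (Set.Icc a b) u → IsODESolOn A h (Set.Icc a b) v →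
      (∀ t ∈ Set.Icc a b, u t ≤ v t) → (∫ t in a..b, u t) ≤ ∫ t in a..b, v t :=
    fun u v hu hv huv => intervalIntegral.integral_mono_on hab
      (hu.contOn.intervalIntegrable_of_Icc hab) (hv.contOn.intervalIntegrable_of_Icc hab) huv
  refine Set.Subset.antisymm ?_ ?_
  · rintro μ ⟨τ, hτ, hb, rfl⟩
    exact ⟨hmono _ _ h₁ hτ fun t ht => (hb t ht).1, hmono _ _ hτ h₂ fun t ht => (hb t ht).2⟩
  rintro μ ⟨hμ1, hμ2⟩
  rcases hab.eq_or_lt with rfl | hlt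
  · refine ⟨τ₁, h₁, fun t ht => ⟨le_rfl, hle t ht⟩, ?_⟩
    simp only [intervalIntegral.integral_same] at *
    linarith
  let Adm : (ℝ → ℝ) → (ℝ → ℝ) → Prop := fun u v =>
    IsODESolOn A h (Set.Icc a b) u ∧ IsODESolOn A h (Set.Icc a b) v ∧
    (∀ t ∈ Set.Icc a b, τ₁ t ≤ u t ∧ u t ≤ τ₂ t) ∧ (∀ t ∈ Set.Icc a b, τ₁ t ≤ v t ∧ v t ≤ τ₂ t) ∧
    (∀ t ∈ Set.Icc a b, u t ≤ v t) ∧ (∫ t in a..b, u t) ≤ μ ∧ μ ≤ ∫ t in a..b, v t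
  let S : Set ℝ := {r | ∃ u v, Adm u v ∧ r = (∫ t in a..b, v t) - ∫ t in a..b, u t}
  have hSne : S.Nonempty := ⟨_, τ₁, τ₂, ⟨h₁, h₂, fun t ht => ⟨le_rfl, hle t ht⟩,
    fun t ht => ⟨hle t ht, le_rfl⟩, hle, hμ1, hμ2⟩, rfl⟩
  have hSb : BddBelow S := by
    refine ⟨0, ?_⟩
    rintro r ⟨u, v, ⟨-, -, -, -, -, h1, h2⟩, rfl⟩
    linarith
  obtain ⟨r, -, hr, hrS⟩ := exists_seq_tendsto_sInf hSne hSb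
  choose u v huv hruv using hrS
  obtain ⟨z, φ, hφ, hz, hzb, hzl, hzi⟩ := aux_seq A h hh a b c d hab hIJ τ₁ τ₂ h₁ h₂ h₁J h₂J u
    (fun n => (huv n).1) (fun n => (huv n).2.2.1)
  obtain ⟨w, ψ, hψ, hw, hwb, hwl, hwi⟩ := aux_seq A h hh a b c d hab hIJ τ₁ τ₂ h₁ h₂ h₁J h₂J
    (fun n => v (φ n)) (fun n => (huv _).2.1) (fun n => (huv _).2.2.2.1)
  have hzi' := hzi.comp hψ.tendsto_atTop
  have hzw : ∀ t ∈ Set.Icc a b, z t ≤ w t := fun t ht =>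
    le_of_tendsto_of_tendsto' ((hzl t ht).comp hψ.tendsto_atTop) (hwl t ht)
      fun n => (huv _).2.2.2.2.1 t ht
  have hz1 : (∫ t in a..b, z t) ≤ μ := le_of_tendsto' hzi fun n => (huv _).2.2.2.2.2.1
  have hw1 : μ ≤ ∫ t in a..b, w t := ge_of_tendsto' hwi fun n => (huv _).2.2.2.2.2.2
  have hmin : (∫ t in a..b, w t) - (∫ t in a..b, z t) = sInf S := by
    refine tendsto_nhds_unique (hwi.sub hzi')
      (((hr.comp hφ.tendsto_atTop).comp hψ.tendsto_atTop).congr fun n => ?_)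
    exact hruv _
  have hJof : ∀ u : ℝ → ℝ, (∀ t ∈ Set.Icc a b, τ₁ t ≤ u t ∧ u t ≤ τ₂ t) →
      Set.MapsTo u (Set.Icc a b) (Set.Icc c d) := fun u hu t ht =>
    ⟨(h₁J ht).1.trans (hu t ht).1, (hu t ht).2.trans (h₂J ht).2⟩
  have hwz : ∀ t ∈ Set.Icc a b, w t ≤ z t := by
    intro t ht
    by_contra hcon
    rw [not_le] at hcon
    obtain ⟨y, hy, hyb, hyt⟩ := aux_between A h hh a b c d hab hIJ z w hz hw (hJof z hzb)
      (hJof w hwb) hzw t ht ((z t + w t) / 2) (by linarith) (by linarith)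
    have hyb' : ∀ t ∈ Set.Icc a b, τ₁ t ≤ y t ∧ y t ≤ τ₂ t := fun t ht =>
      ⟨(hzb t ht).1.trans (hyb t ht).1, (hyb t ht).2.trans (hwb t ht).2⟩
    have hi1 : (∫ t in a..b, z t) < ∫ t in a..b, y t :=
      intervalIntegral.integral_lt_integral_of_continuousOn_of_le_of_exists_lt hlt hz.contOn
        hy.contOn (fun t ht => (hyb t (Set.Ioc_subset_Icc_self ht)).1) ⟨t, ht, by linarith⟩
    have hi2 : (∫ t in a..b, y t) < ∫ t in a..b, w t :=
      intervalIntegral.integral_lt_integral_of_continuousOn_of_le_of_exists_lt hlt hy.contOn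
        hw.contOn (fun t ht => (hyb t (Set.Ioc_subset_Icc_self ht)).2) ⟨t, ht, by linarith⟩
    rcases le_total (∫ t in a..b, y t) μ with hc | hc
    · have := csInf_le hSb (show _ ∈ S from ⟨y, w, ⟨hy, hw, hyb', hwb,
        fun t ht => (hyb t ht).2, hc, hw1⟩, rfl⟩)
      linarith
    · have := csInf_le hSb (show _ ∈ S from ⟨z, y, ⟨hz, hy, hzb, hyb',
        fun t ht => (hyb t ht).1, hz1, hc⟩, rfl⟩)
      linarith
  exact ⟨z, hz, hzb, le_antisymm (hw1.trans (hmono _ _ hw hz hwz)) hz1⟩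
end
end
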